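/- Let λ>0 and 1<q<p<∞, r=pq/(p−q), q'=q/(q−1), and let v be a non-negative measurable weight on (0,∞) with v^{p'} locally integrable. Then the Laplace-type operator 𝓛 is compact from L^p to L^q if and only if B=(∫_0^∞ t^{−λr/q} (∫_0^t v^{p'})^{r/q'} v(t)^{p'} dt)^{1/r} < ∞. -/

import Mathlib

open MeasureTheory Set Filter Topology
open scoped ENNReal NNReal

noncomputable section

/-- The Laplace-type operator `𝓛f(x) = ∫_0^∞ e^{-x y^λ} f(y) v(y) dy`. -/
def Lap (lam : ℝ) (v f : ℝ → ℝ) : ℝ → ℝ :=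
  fun x => ∫ y in Ioi (0:ℝ), Real.exp (-(x * y ^ lam)) * f y * v y

/-- `(∫_0^∞ |g|^r)^{1/r}`, the `L^r(0,∞)` (quasi-)norm. -/
def eN (r : ℝ) (g : ℝ → ℝ) : ℝ≥0∞ :=
  (∫⁻ x in Ioi (0:ℝ), ENNReal.ofReal |g x| ^ r) ^ (1/r)

/-- Compactness of the Laplace-type operator from `L^p` to `L^q` (`q ≥ 1`): the image of the
closed unit ball of `L^p` is relatively compact in the complete space `L^q`; equivalently,
every sequence of the unit ball has a subsequence whose image is Cauchy in the `L^q` norm. -/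
def LapCompact (lam p q : ℝ) (v : ℝ → ℝ) : Prop :=
  ∀ f : ℕ → ℝ → ℝ, (∀ n, Measurable (f n)) → (∀ n, eN p (f n) ≤ 1) →
    ∃ φ : ℕ → ℕ, StrictMono φ ∧
      ∀ ε : ℝ, 0 < ε → ∃ N : ℕ, ∀ m, N ≤ m → ∀ n, N ≤ n →
        eN q (fun x => Lap lam v (f (φ m)) x - Lap lam v (f (φ n)) x) < ENNReal.ofReal ε

/-- The primitive `t ↦ ∫_0^t w` of an extended non-negative function. -/
def prim (w : ℝ → ℝ≥0∞) (t : ℝ) : ℝ≥0∞ := ∫⁻ y in Ioo (0:ℝ) t, w y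

lemma prim_mono (w : ℝ → ℝ≥0∞) : Monotone (prim w) := fun _ _ h =>
  lintegral_mono_set (Ioo_subset_Ioo_right h)

@[fun_prop]
lemma measurable_prim (w : ℝ → ℝ≥0∞) : Measurable (prim w) := (prim_mono w).measurable

lemma exists_prim_eq {w : ℝ → ℝ≥0∞} (hw : Measurable w) {T : ℝ} (hT : prim w T < ⊤)
    {c : ℝ} (hc0 : 0 ≤ c) (hcT : ENNReal.ofReal c < prim w T) :
    ∃ z, z < T ∧ prim w z = ENNReal.ofReal c := by
  have hTpos : 0 < T := by
    by_contra h
    have : prim w T = 0 := by simp [prim, Ioo_eq_empty_of_le (not_lt.1 h)]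
    simp [this] at hcT
  have hfin : ∀ y ∈ Icc 0 T, prim w y < ⊤ := fun y hy => (prim_mono w hy.2).trans_lt hT
  have key : ∀ y ∈ Icc 0 T, ∫ t in Ioc 0 y, (w t).toReal = (prim w y).toReal := by
    intro y hy
    rw [integral_Ioc_eq_integral_Ioo, integral_toReal hw.aemeasurable]
    · rfl
    · exact ae_lt_top hw (hfin y hy).ne
  have hint : IntegrableOn (fun t => (w t).toReal) (Icc 0 T) := by
    rw [integrableOn_Icc_iff_integrableOn_Ioo]
    exact integrable_toReal_of_lintegral_ne_top hw.aemeasurable hT.ne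
  have hcont := intervalIntegral.continuousOn_primitive hint
  have hiv := intermediate_value_Icc hTpos.le hcont
  have hmem : c ∈ Icc (∫ t in Ioc (0:ℝ) 0, (w t).toReal) (∫ t in Ioc 0 T, (w t).toReal) := by
    rw [key T ⟨hTpos.le, le_rfl⟩]
    refine ⟨by simpa using hc0, ?_⟩
    exact (ENNReal.ofReal_le_iff_le_toReal hT.ne).1 hcT.le
  obtain ⟨z, hz, hzc⟩ := hiv hmem
  have hzc' : (prim w z).toReal = c := (key z hz).symm.trans hzc
  have hz2 : prim w z = ENNReal.ofReal c := by
    rw [← hzc', ENNReal.ofReal_toReal (hfin z hz).ne]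
  refine ⟨z, lt_of_le_of_ne hz.2 ?_, hz2⟩
  rintro rfl
  exact hcT.ne hz2.symm

/-- Probability integral transform: the measure `w dy` on `(0, T)` is carried to Lebesgue measure
on `(0, ∫_0^T w)` by the primitive of `w`. -/
lemma map_prim_withDensity {w : ℝ → ℝ≥0∞} (hw : Measurable w) {T : ℝ} (hT : prim w T < ⊤) :
    Measure.map (fun y => (prim w y).toReal) ((volume.restrict (Ioo 0 T)).withDensity w)
      = volume.restrict (Ioo 0 (prim w T).toReal) := by
  set m := (volume.restrict (Ioo 0 T)).withDensity w with hm
  have hmeas : Measurable (fun y => (prim w y).toReal) := (measurable_prim w).ennreal_toReal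
  have huniv : m univ = prim w T := by simp [hm, prim]
  have hfin : IsFiniteMeasure m := ⟨by rw [huniv]; exact hT⟩
  have hfinmap : IsFiniteMeasure (Measure.map (fun y => (prim w y).toReal) m) :=
    ⟨by rw [Measure.map_apply hmeas .univ]; simp [huniv, hT]⟩
  have hIoo : ∀ z ≤ T, m (Ioo 0 z) = prim w z := by
    intro z hz
    rw [hm, withDensity_apply _ measurableSet_Ioo, Measure.restrict_restrict measurableSet_Ioo,
      inter_eq_left.2 (Ioo_subset_Ioo_right hz)]
    rfl
  have hnull : m (Ioo 0 T)ᶜ = 0 := by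
    rw [hm, withDensity_apply _ measurableSet_Ioo.compl, Measure.restrict_restrict
      measurableSet_Ioo.compl]
    simp
  have hinter : ∀ s, m s = m (s ∩ Ioo 0 T) := fun s =>
    (measure_inter_conull' (measure_mono_null (fun x hx => hx.2) hnull)).symm
  refine Measure.ext_of_Iic _ _ fun c => ?_
  rw [Measure.map_apply hmeas measurableSet_Iic, Measure.restrict_apply measurableSet_Iic]
  rcases lt_or_ge c 0 with hc | hc
  · have h1 : (fun y => (prim w y).toReal) ⁻¹' Iic c = ∅ := by
      ext y
      simp only [mem_preimage, mem_Iic, mem_empty_iff_false, iff_false, not_le]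
      exact hc.trans_le ENNReal.toReal_nonneg
    have h2 : Iic c ∩ Ioo 0 (prim w T).toReal = ∅ := by
      ext y
      simp only [mem_inter_iff, mem_Iic, mem_Ioo, mem_empty_iff_false, iff_false]
      intro h
      linarith [h.1, h.2.1]
    simp [h1, h2]
  rcases le_or_gt (prim w T) (ENNReal.ofReal c) with hcT | hcT
  · have hcT' : (prim w T).toReal ≤ c := ENNReal.toReal_le_of_le_ofReal hc hcT
    have h2 : Iic c ∩ Ioo 0 (prim w T).toReal = Ioo 0 (prim w T).toReal :=
      inter_eq_right.2 fun y hy => (hy.2.le.trans hcT')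
    rw [h2, Real.volume_Ioo, sub_zero, ENNReal.ofReal_toReal hT.ne, ← hIoo T le_rfl,
      hinter (_ ⁻¹' _)]
    congr 1
    refine inter_eq_right.2 fun y hy => ?_
    exact (ENNReal.toReal_mono hT.ne (prim_mono w hy.2.le)).trans hcT'
  · have hcT' : c < (prim w T).toReal := (ENNReal.ofReal_lt_iff_lt_toReal hc hT.ne).1 hcT
    have h2 : volume (Iic c ∩ Ioo 0 (prim w T).toReal) = ENNReal.ofReal c := by
      have : Iic c ∩ Ioo 0 (prim w T).toReal = Ioc 0 c := by
        ext y
        simp only [mem_inter_iff, mem_Iic, mem_Ioo, mem_Ioc]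
        constructor
        · intro h; exact ⟨h.2.1, h.1⟩
        · intro h; exact ⟨h.2, h.1, h.2.trans_lt hcT'⟩
      rw [this, Real.volume_Ioc, sub_zero]
    rw [h2]
    apply le_antisymm
    · refine le_of_forall_gt_imp_ge_of_dense fun d hd => ?_
      obtain ⟨e, hce, hed⟩ := exists_between (lt_min hd hcT)
      have hetop : e ≠ ⊤ := (hed.trans_le (min_le_right _ _)).trans hT |>.ne
      obtain ⟨z, hzT, hz⟩ := exists_prim_eq hw hT (c := e.toReal) ENNReal.toReal_nonneg
        (by rw [ENNReal.ofReal_toReal hetop]; exact hed.trans_le (min_le_right _ _))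
      rw [ENNReal.ofReal_toReal hetop] at hz
      refine le_trans ?_ (hed.le.trans (min_le_left _ _))
      rw [← hz, ← hIoo z hzT.le, hinter]
      refine measure_mono fun y hy => ⟨hy.2.1, ?_⟩
      by_contra hzy
      have h3 : prim w z ≤ prim w y := prim_mono w (not_lt.1 hzy)
      have h4 : (prim w y).toReal ≤ c := hy.1
      have h5 : prim w y ≤ ENNReal.ofReal c := by
        rw [← ENNReal.ofReal_toReal ((prim_mono w hy.2.2.le).trans_lt hT).ne]
        exact ENNReal.ofReal_le_ofReal h4
      exact absurd (hz ▸ h3.trans h5) (not_le.2 hce)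
    · obtain ⟨z, hzT, hz⟩ := exists_prim_eq hw hT hc hcT
      rw [← hz, ← hIoo z hzT.le]
      refine measure_mono fun y hy => ?_
      have : prim w y ≤ ENNReal.ofReal c := hz ▸ prim_mono w hy.2.le
      exact ENNReal.toReal_le_of_le_ofReal hc this

lemma lintegral_comp_prim {w : ℝ → ℝ≥0∞} (hw : Measurable w) {T : ℝ} (hT : prim w T < ⊤)
    {φ : ℝ≥0∞ → ℝ≥0∞} (hφ : Measurable φ) :
    ∫⁻ y in Ioo 0 T, φ (prim w y) * w y
      = ∫⁻ u in Ioo 0 (prim w T).toReal, φ (ENNReal.ofReal u) := by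
  have hmeas : Measurable (fun y => (prim w y).toReal) := (measurable_prim w).ennreal_toReal
  have hφ' : Measurable fun u => φ (ENNReal.ofReal u) := hφ.comp ENNReal.measurable_ofReal
  rw [← map_prim_withDensity hw hT, lintegral_map hφ' hmeas,
    lintegral_withDensity_eq_lintegral_mul _ hw (g := fun y => φ (ENNReal.ofReal (prim w y).toReal))
      (hφ'.comp hmeas)]
  refine setLIntegral_congr_fun measurableSet_Ioo fun y hy => ?_
  have : prim w y ≠ ⊤ := ((prim_mono w hy.2.le).trans_lt hT).ne
  simp [ENNReal.ofReal_toReal this, mul_comm]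

lemma lintegral_Ioo_rpow {a c : ℝ} (ha : -1 < a) (hc : 0 ≤ c) :
    ∫⁻ u in Ioo 0 c, ENNReal.ofReal u ^ a = ENNReal.ofReal (c ^ (a + 1) / (a + 1)) := by
  have h1 : ∫⁻ u in Ioo 0 c, ENNReal.ofReal u ^ a = ∫⁻ u in Ioo 0 c, ENNReal.ofReal (u ^ a) :=
    setLIntegral_congr_fun measurableSet_Ioo fun u hu => ENNReal.ofReal_rpow_of_pos hu.1
  have hint : IntegrableOn (fun u : ℝ => u ^ a) (Ioo 0 c) :=
    (intervalIntegrable_iff_integrableOn_Ioo_of_le hc).1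
      (intervalIntegral.intervalIntegrable_rpow' ha)
  rw [h1, ← ofReal_integral_eq_lintegral_ofReal hint, ← integral_Ioc_eq_integral_Ioo,
    ← intervalIntegral.integral_of_le hc, integral_rpow (Or.inl ha),
    Real.zero_rpow (by linarith), sub_zero]
  exact (ae_restrict_iff' measurableSet_Ioo).2 (.of_forall fun u hu => Real.rpow_nonneg hu.1.le _)

lemma lintegral_Ioi_rpow {a c : ℝ} (ha : 0 < a) (hc : 0 < c) :
    ∫⁻ u in Ioi c, ENNReal.ofReal u ^ (-1 - a) = ENNReal.ofReal (c ^ (-a) / a) := by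
  have h1 : ∫⁻ u in Ioi c, ENNReal.ofReal u ^ (-1 - a)
      = ∫⁻ u in Ioi c, ENNReal.ofReal (u ^ (-1 - a)) :=
    setLIntegral_congr_fun measurableSet_Ioi fun u hu => ENNReal.ofReal_rpow_of_pos (hc.trans hu)
  rw [h1, ← ofReal_integral_eq_lintegral_ofReal (integrableOn_Ioi_rpow_of_lt (by linarith) hc),
    integral_Ioi_rpow_of_lt (by linarith) hc]
  · congr 1
    have : -1 - a + 1 = -a := by ring
    rw [this, neg_div_neg_eq]
  · exact (ae_restrict_iff' measurableSet_Ioi).2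
      (.of_forall fun u hu => Real.rpow_nonneg (hc.trans hu).le _)

/-- `∫_0^T W^a dW = W(T)^{a+1}/(a+1)` for the primitive `W` of `w`. -/
lemma lintegral_prim_rpow_mul {w : ℝ → ℝ≥0∞} (hw : Measurable w) {T : ℝ} (hT : prim w T < ⊤)
    {a : ℝ} (ha : -1 < a) :
    ∫⁻ y in Ioo 0 T, prim w y ^ a * w y
      = prim w T ^ (a + 1) * ENNReal.ofReal (1 / (a + 1)) := by
  have ha1 : 0 < a + 1 := by linarith
  rw [lintegral_comp_prim hw hT (φ := fun u => u ^ a) (by fun_prop),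
    lintegral_Ioo_rpow ha ENNReal.toReal_nonneg, div_eq_mul_one_div,
    ENNReal.ofReal_mul (by positivity), ← ENNReal.ofReal_rpow_of_nonneg ENNReal.toReal_nonneg
    ha1.le, ENNReal.ofReal_toReal hT.ne]

/-- `∫_y^∞ W^{-1-c} dW ≤ W(y)^{-c}/c` for the primitive `W` of `w`. -/
lemma lintegral_Ioi_prim_rpow_mul_le {w : ℝ → ℝ≥0∞} (hw : Measurable w)
    (hfin : ∀ T, prim w T < ⊤) {y : ℝ} (hy : 0 < y) {c : ℝ} (hc : 0 < c) :
    ∫⁻ t in Ioi y, prim w t ^ (-1 - c) * w t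
      ≤ prim w y ^ (-c) * ENNReal.ofReal (1 / c) := by
  rcases eq_or_ne (prim w y) 0 with h0 | h0
  · rw [h0, ENNReal.zero_rpow_of_neg (by linarith), ENNReal.top_mul]
    · exact le_top
    · simpa using hc
  have hpos : 0 < (prim w y).toReal := ENNReal.toReal_pos h0 (hfin y).ne
  have hU : Ioi y = ⋃ n : ℕ, Ioo y n := by
    ext t
    simp only [mem_Ioi, mem_iUnion, mem_Ioo]
    exact ⟨fun h => (exists_nat_gt t).imp fun n hn => ⟨h, hn⟩, fun ⟨_, h⟩ => h.1⟩
  have hdir : Directed (· ⊆ ·) fun n : ℕ => Ioo y (n : ℝ) :=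
    (monotone_nat_of_le_succ fun n => Ioo_subset_Ioo_right (by simp)).directed_le
  rw [hU, setLIntegral_iUnion_of_directed _ hdir]
  refine iSup_le fun n => ?_
  set φ : ℝ≥0∞ → ℝ≥0∞ := (Ici (prim w y)).indicator fun u => u ^ (-1 - c) with hφ
  have hφm : Measurable φ := Measurable.indicator (by fun_prop) measurableSet_Ici
  calc ∫⁻ t in Ioo y (n:ℝ), prim w t ^ (-1 - c) * w t
      = ∫⁻ t in Ioo y (n:ℝ), φ (prim w t) * w t := by
        refine setLIntegral_congr_fun measurableSet_Ioo fun t ht => ?_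
        have : prim w t ∈ Ici (prim w y) := prim_mono w ht.1.le
        simp only [hφ, indicator_of_mem this]
    _ ≤ ∫⁻ t in Ioo 0 (n:ℝ), φ (prim w t) * w t := lintegral_mono_set (Ioo_subset_Ioo_left hy.le)
    _ = ∫⁻ u in Ioo 0 (prim w n).toReal, φ (ENNReal.ofReal u) :=
        lintegral_comp_prim hw (hfin n) hφm
    _ ≤ ∫⁻ u, (Ici (prim w y).toReal).indicator (fun u => ENNReal.ofReal u ^ (-1 - c)) u := by
        refine (setLIntegral_le_lintegral _ _).trans (lintegral_mono fun u => ?_)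
        simp only [hφ, indicator, mem_Ici]
        split_ifs with h1 h2
        · exact le_rfl
        · exfalso
          rcases le_or_gt 0 u with hu | hu
          · exact h2 (ENNReal.toReal_le_of_le_ofReal hu h1)
          · rw [ENNReal.ofReal_of_nonpos hu.le] at h1
            exact h0 (le_antisymm h1 bot_le)
        · exact bot_le
        · exact le_rfl
    _ = prim w y ^ (-c) * ENNReal.ofReal (1 / c) := by
        rw [lintegral_indicator measurableSet_Ici, ← restrict_Ioi_eq_restrict_Ici,
          lintegral_Ioi_rpow hc hpos, div_eq_mul_one_div, ENNReal.ofReal_mul (by positivity),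
          ← ENNReal.ofReal_rpow_of_pos hpos, ENNReal.ofReal_toReal (hfin y).ne]

lemma ae_eq_zero_of_prim_eq_zero {w : ℝ → ℝ≥0∞} (hw : Measurable w) {T : ℝ}
    (hT : prim w T < ⊤) : ∀ᵐ y ∂volume.restrict (Ioo 0 T), prim w y = 0 → w y = 0 := by
  have h := lintegral_comp_prim hw hT (φ := indicator {0} 1)
    (measurable_one.indicator (measurableSet_singleton 0))
  have h0 : ∫⁻ u in Ioo 0 (prim w T).toReal,
      indicator {0} (1 : ℝ≥0∞ → ℝ≥0∞) (ENNReal.ofReal u) = 0 := by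
    rw [setLIntegral_congr_fun (g := fun _ => 0) measurableSet_Ioo, lintegral_zero]
    intro u hu
    have := hu.1
    simp [indicator, this]
  rw [h0, lintegral_eq_zero_iff] at h
  · filter_upwards [h] with y hy hy0
    simpa [hy0] using hy
  · exact ((measurable_one.indicator (measurableSet_singleton 0)).comp (measurable_prim w)).mul hw

/-- Tonelli's theorem on the triangle `0 < y < t`. -/
lemma lintegral_mul_lintegral_Ioi {a b : ℝ → ℝ≥0∞} (ha : Measurable a) (hb : Measurable b) :
    ∫⁻ y in Ioi (0:ℝ), a y * ∫⁻ t in Ioi y, b t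
      = ∫⁻ t in Ioi (0:ℝ), b t * prim a t := by
  have hm : Measurable (Function.uncurry fun y t : ℝ =>
      {z : ℝ × ℝ | z.1 < z.2}.indicator (fun z => a z.1 * b z.2) (y, t)) := by
    simp only [Function.uncurry_def]
    exact ((ha.comp measurable_fst).mul (hb.comp measurable_snd)).indicator
      (measurableSet_lt measurable_fst measurable_snd)
  have h1 : ∀ y ∈ Ioi (0:ℝ), a y * ∫⁻ t in Ioi y, b t = ∫⁻ t in Ioi (0:ℝ),
      {z : ℝ × ℝ | z.1 < z.2}.indicator (fun z => a z.1 * b z.2) (y, t) := by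
    intro y hy
    rw [← lintegral_const_mul _ hb, ← lintegral_indicator measurableSet_Ioi,
      ← lintegral_indicator measurableSet_Ioi]
    refine lintegral_congr fun t => ?_
    simp only [indicator, mem_Ioi, mem_ofPred_eq] at hy ⊢
    split_ifs with h1 h2 h3 <;> first | rfl | (exfalso; linarith)
  have h2 : ∀ t ∈ Ioi (0:ℝ), b t * prim a t = ∫⁻ y in Ioi (0:ℝ),
      {z : ℝ × ℝ | z.1 < z.2}.indicator (fun z => a z.1 * b z.2) (y, t) := by
    intro t _
    rw [prim, ← lintegral_const_mul _ ha, ← lintegral_indicator measurableSet_Ioi,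
      ← lintegral_indicator measurableSet_Ioo]
    refine lintegral_congr fun y => ?_
    simp only [indicator, mem_Ioi, mem_Ioo, mem_ofPred_eq, mul_comm (b t)]
    by_cases h1 : 0 < y <;> by_cases h2 : y < t <;> simp [h1, h2]
  rw [setLIntegral_congr_fun measurableSet_Ioi h1, setLIntegral_congr_fun measurableSet_Ioi h2]
  exact lintegral_lintegral_swap hm.aemeasurable

/-- The kernel `-∂_t e^{-x t^λ}`. -/
def lapKernel (lam x t : ℝ) : ℝ := lam * x * t ^ (lam - 1) * Real.exp (-(x * t ^ lam))

lemma measurable_lapKernel (lam : ℝ) :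
    Measurable (Function.uncurry fun x t => ENNReal.ofReal (lapKernel lam x t)) := by
  unfold lapKernel Function.uncurry
  fun_prop

lemma lintegral_lapKernel {lam x y : ℝ} (hlam : 0 < lam) (hx : 0 < x) (hy : 0 ≤ y) :
    ∫⁻ t in Ioi y, ENNReal.ofReal (lapKernel lam x t)
      = ENNReal.ofReal (Real.exp (-(x * y ^ lam))) := by
  have hc : ContinuousWithinAt (fun t : ℝ => -Real.exp (-(x * t ^ lam))) (Ici y) y := by
    apply Continuous.continuousWithinAt
    have : Continuous fun t : ℝ => t ^ lam := Real.continuous_rpow_const hlam.le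
    fun_prop
  have hd : ∀ t ∈ Ioi y, HasDerivAt (fun t : ℝ => -Real.exp (-(x * t ^ lam)))
      (lapKernel lam x t) t := by
    intro t ht
    have ht0 : t ≠ 0 := (hy.trans_lt ht).ne'
    have h1 := ((Real.hasDerivAt_rpow_const (p := lam) (Or.inl ht0)).const_mul x).neg.exp.neg
    refine h1.congr_deriv ?_
    simp only [lapKernel, Pi.neg_apply]
    ring
  have hn : ∀ t ∈ Ioi y, 0 ≤ lapKernel lam x t := by
    intro t ht
    have ht0 : 0 < t := hy.trans_lt ht
    unfold lapKernel
    positivity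
  have hl : Tendsto (fun t : ℝ => -Real.exp (-(x * t ^ lam))) atTop (𝓝 0) := by
    have h1 : Tendsto (fun t : ℝ => x * t ^ lam) atTop atTop :=
      (tendsto_rpow_atTop hlam).const_mul_atTop hx
    simpa using (Real.tendsto_exp_neg_atTop_nhds_zero.comp h1).neg
  rw [← ofReal_integral_eq_lintegral_ofReal (integrableOn_Ioi_deriv_of_nonneg hc hd hn hl)
    ((ae_restrict_iff' measurableSet_Ioi).2 (.of_forall hn)),
    integral_Ioi_of_hasDerivAt_of_nonneg hc hd hn hl]
  simp

lemma lintegral_lapKernel_left {lam t : ℝ} (hlam : 0 < lam) (ht : 0 < t) :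
    ∫⁻ x in Ioi (0:ℝ), ENNReal.ofReal (lapKernel lam x t)
      = ENNReal.ofReal lam * ENNReal.ofReal t ^ (-1 - lam) := by
  have htl : 0 < t ^ lam := Real.rpow_pos_of_pos ht _
  have hI : ∫ x in Ioi (0:ℝ), lapKernel lam x t = lam * t ^ (-1 - lam) := by
    have h := Real.integral_rpow_mul_exp_neg_mul_Ioi (a := 2) (by norm_num) htl
    have h2 : ∀ x ∈ Ioi (0:ℝ), lapKernel lam x t
        = lam * t ^ (lam - 1) * (x ^ ((2:ℝ) - 1) * Real.exp (-(t ^ lam * x))) := by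
      intro x _
      have : (2:ℝ) - 1 = 1 := by norm_num
      rw [lapKernel, this, Real.rpow_one, mul_comm x (t ^ lam)]
      ring
    rw [setIntegral_congr_fun measurableSet_Ioi h2, integral_const_mul, h, Real.Gamma_two, mul_one,
      one_div, Real.inv_rpow htl.le, ← Real.rpow_mul ht.le, ← Real.rpow_neg ht.le, mul_assoc,
      ← Real.rpow_add ht]
    congr 2
    ring
  have hpos : 0 < lam * t ^ (-1 - lam) := by positivity
  rw [← ofReal_integral_eq_lintegral_ofReal
    (Integrable.of_integral_ne_zero (by rw [hI]; exact hpos.ne')), hI,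
    ENNReal.ofReal_mul hlam.le, ENNReal.ofReal_rpow_of_pos ht]
  refine (ae_restrict_iff' measurableSet_Ioi).2 (.of_forall fun x hx => ?_)
  have : (0:ℝ) < x := hx
  unfold lapKernel
  positivity

/-- Jensen's inequality for a sub-probability density. -/
lemma lintegral_mul_rpow_le {α : Type*} [MeasurableSpace α] {μ : Measure α} {k h : α → ℝ≥0∞}
    (hk : Measurable k) (hh : Measurable h) (hk1 : ∫⁻ t, k t ∂μ ≤ 1) {q : ℝ} (hq : 1 < q) :
    (∫⁻ t, k t * h t ∂μ) ^ q ≤ ∫⁻ t, k t * h t ^ q ∂μ := by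
  have hq0 : 0 < q := by linarith
  have hq1 : 1 / q ≤ 1 := by rw [div_le_one hq0]; exact hq.le
  have h1 := ENNReal.lintegral_mul_norm_pow_le (μ := μ) hk.aemeasurable
    (hk.mul (hh.pow_const q)).aemeasurable (p := 1 - 1 / q) (q := 1 / q) (by linarith)
    (by positivity) (by ring)
  have h2 : ∀ t, k t ^ (1 - 1 / q) * (k * fun t => h t ^ q) t ^ (1 / q) = k t * h t := by
    intro t
    rw [Pi.mul_apply, ENNReal.mul_rpow_of_nonneg _ _ (by positivity), ← ENNReal.rpow_mul,
      mul_one_div_cancel hq0.ne', ENNReal.rpow_one, ← mul_assoc,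
      ← ENNReal.rpow_add_of_nonneg _ _ (by linarith) (by positivity)]
    simp
  simp only [h2] at h1
  calc (∫⁻ t, k t * h t ∂μ) ^ q
      ≤ ((∫⁻ t, k t ∂μ) ^ (1 - 1 / q) * (∫⁻ t, k t * h t ^ q ∂μ) ^ (1 / q)) ^ q :=
        ENNReal.rpow_le_rpow h1 hq0.le
    _ ≤ (1 * (∫⁻ t, k t * h t ^ q ∂μ) ^ (1 / q)) ^ q := by
        gcongr
        exact ENNReal.rpow_le_one hk1 (by linarith)
    _ = _ := by rw [one_mul, ← ENNReal.rpow_mul, one_div_mul_cancel hq0.ne', ENNReal.rpow_one]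

lemma lintegral_Ioi_rpow_eq {lam y : ℝ} (hlam : 0 < lam) (hy : 0 < y) :
    ∫⁻ t in Ioi y, ENNReal.ofReal lam * ENNReal.ofReal t ^ (-1 - lam)
      = ENNReal.ofReal y ^ (-lam) := by
  rw [lintegral_const_mul _ (by fun_prop), lintegral_Ioi_rpow hlam hy,
    ← ENNReal.ofReal_mul hlam.le, mul_div_cancel₀ _ hlam.ne', ENNReal.ofReal_rpow_of_pos hy]

/-- The Laplace transform of an extended non-negative function. -/
def eLap (lam : ℝ) (g : ℝ → ℝ≥0∞) (x : ℝ) : ℝ≥0∞ :=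
  ∫⁻ y in Ioi (0:ℝ), ENNReal.ofReal (Real.exp (-(x * y ^ lam))) * g y

/-- The `L^q` norm of the Laplace transform is controlled by the primitive. -/
lemma lintegral_eLap_rpow_le {lam q : ℝ} (hlam : 0 < lam) (hq : 1 < q) {g : ℝ → ℝ≥0∞}
    (hg : Measurable g) (hfin : ∀ t, prim g t < ⊤) :
    ∫⁻ x in Ioi (0:ℝ), eLap lam g x ^ q
      ≤ ENNReal.ofReal q * ∫⁻ y in Ioi (0:ℝ),
          ENNReal.ofReal y ^ (-lam) * (prim g y ^ (q - 1) * g y) := by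
  have hk := measurable_lapKernel lam
  have hkx : ∀ x, Measurable fun t => ENNReal.ofReal (lapKernel lam x t) := fun x =>
    hk.comp measurable_prodMk_left
  have hkt : ∀ t, Measurable fun x => ENNReal.ofReal (lapKernel lam x t) := fun t =>
    hk.comp measurable_prodMk_right
  have hG := measurable_prim g
  have hrep : ∀ x ∈ Ioi (0:ℝ), eLap lam g x
      = ∫⁻ t in Ioi (0:ℝ), ENNReal.ofReal (lapKernel lam x t) * prim g t := by
    intro x hx
    rw [← lintegral_mul_lintegral_Ioi hg (hkx x)]
    refine setLIntegral_congr_fun measurableSet_Ioi fun y hy => ?_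
    simp only [lintegral_lapKernel hlam hx (le_of_lt hy), mul_comm]
  have hmass : ∀ x ∈ Ioi (0:ℝ), ∫⁻ t in Ioi (0:ℝ), ENNReal.ofReal (lapKernel lam x t) ≤ 1 := by
    intro x hx
    rw [lintegral_lapKernel hlam hx le_rfl]
    simp [Real.zero_rpow hlam.ne']
  have hpow : Measurable fun y => prim g y ^ (q - 1) * g y := (hG.pow_const _).mul hg
  calc ∫⁻ x in Ioi (0:ℝ), eLap lam g x ^ q
      ≤ ∫⁻ x in Ioi (0:ℝ), ∫⁻ t in Ioi (0:ℝ),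
          ENNReal.ofReal (lapKernel lam x t) * prim g t ^ q := by
        refine setLIntegral_mono' measurableSet_Ioi fun x hx => ?_
        rw [hrep x hx]
        exact lintegral_mul_rpow_le (hkx x) hG (hmass x hx) hq
    _ = ∫⁻ t in Ioi (0:ℝ), ∫⁻ x in Ioi (0:ℝ),
          ENNReal.ofReal (lapKernel lam x t) * prim g t ^ q := by
        refine lintegral_lintegral_swap (Measurable.aemeasurable ?_)
        exact hk.mul ((hG.comp measurable_snd).pow_const q)
    _ = ∫⁻ t in Ioi (0:ℝ), (ENNReal.ofReal lam * ENNReal.ofReal t ^ (-1 - lam)) *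
          (ENNReal.ofReal q * prim (fun y => prim g y ^ (q - 1) * g y) t) := by
        refine setLIntegral_congr_fun measurableSet_Ioi fun t ht => ?_
        rw [lintegral_mul_const _ (hkt t), lintegral_lapKernel_left hlam ht]
        congr 1
        have h := lintegral_prim_rpow_mul hg (hfin t) (a := q - 1) (by linarith)
        rw [sub_add_cancel] at h
        rw [prim.eq_def (fun y => prim g y ^ (q - 1) * g y) t, h, mul_left_comm,
          ← ENNReal.ofReal_mul (by linarith),
          mul_one_div_cancel (by linarith), ENNReal.ofReal_one, mul_one]
    _ = ENNReal.ofReal q * ∫⁻ t in Ioi (0:ℝ),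
          (ENNReal.ofReal lam * ENNReal.ofReal t ^ (-1 - lam)) *
          prim (fun y => prim g y ^ (q - 1) * g y) t := by
        rw [← lintegral_const_mul _ (by fun_prop)]
        exact lintegral_congr fun t => by ring
    _ = _ := by
        rw [← lintegral_mul_lintegral_Ioi hpow (by fun_prop)]
        congr 1
        refine setLIntegral_congr_fun measurableSet_Ioi fun y hy => ?_
        simp only [lintegral_Ioi_rpow_eq hlam hy, mul_comm]

lemma prim_mul_le {p p' : ℝ} (hpp : p.HolderConjugate p') {f v : ℝ → ℝ≥0∞} (hf : Measurable f)
    (hv : Measurable v) (t : ℝ) :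
    prim (fun y => f y * v y) t
      ≤ prim (fun y => f y ^ p) t ^ (1 / p) * prim (fun y => v y ^ p') t ^ (1 / p') :=
  ENNReal.lintegral_mul_le_Lp_mul_Lq _ hpp hf.aemeasurable hv.aemeasurable

/-- Hölder's inequality for `∫_0^t f v` weighted by a power of the primitive `V` of `v^{p'}`. -/
lemma prim_div_rpow_le {p p' : ℝ} (hpp : p.HolderConjugate p') {f v : ℝ → ℝ≥0∞}
    (hf : Measurable f) (hv : Measurable v) (hfin : ∀ T, prim (fun y => v y ^ p') T < ⊤) (t : ℝ) :
    (prim (fun y => f y * v y) t / prim (fun y => v y ^ p') t) ^ p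
      ≤ ENNReal.ofReal p' ^ (p - 1) *
        (prim (fun y => f y ^ p * prim (fun y => v y ^ p') y ^ (1 / p')) t *
          prim (fun y => v y ^ p') t ^ (-1 - 1 / p')) := by
  set w : ℝ → ℝ≥0∞ := fun y => v y ^ p' with hw
  have hp0 := hpp.pos
  have hp'0 := hpp.symm.pos
  have hp1 := hpp.lt
  have hwm : Measurable w := hv.pow_const _
  have hVm := measurable_prim w
  have hinv : 1 / p + 1 / p' = 1 := by simpa using hpp.inv_add_inv_eq_one
  have hone : 1 - 1 / p = 1 / p' := by linarith
  rcases eq_or_ne (prim w t) 0 with h0 | h0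
  · have hF : prim (fun y => f y * v y) t = 0 := by
      have h1 : prim w t = 0 := h0
      rw [prim, lintegral_eq_zero_iff hwm] at h1
      rw [prim, lintegral_eq_zero_iff (by fun_prop)]
      filter_upwards [h1] with y hy
      have : v y = 0 := (ENNReal.rpow_eq_zero_iff_of_pos hp'0).1 hy
      simp [this]
    rw [hF, ENNReal.zero_div, ENNReal.zero_rpow_of_pos hp0]
    exact bot_le
  set A := prim (fun y => f y ^ p * prim w y ^ (1 / p')) t with hA
  have hH : prim (fun y => f y * v y) t ≤ A ^ (1 / p) *
      (prim w t ^ (1 / p') * ENNReal.ofReal p') ^ (1 / p') := by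
    have h1 := ENNReal.lintegral_mul_norm_pow_le (μ := volume.restrict (Ioo 0 t))
      (f := fun y => f y ^ p * prim w y ^ (1 / p')) (g := fun y => prim w y ^ (-(1 / p)) * w y)
      (by fun_prop) (by fun_prop) (p := 1 / p) (q := 1 / p') (by positivity) (by positivity) hinv
    rw [lintegral_prim_rpow_mul hwm (hfin t) (by rw [neg_lt_neg_iff, div_lt_one hp0]; exact hp1),
      neg_add_eq_sub, hone, one_div_one_div] at h1
    refine le_trans (lintegral_mono_ae ?_) h1
    filter_upwards [ae_eq_zero_of_prim_eq_zero hwm (hfin t)] with y hy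
    rcases eq_or_ne (prim w y) 0 with hV0 | hV0
    · have : v y = 0 := (ENNReal.rpow_eq_zero_iff_of_pos hp'0).1 (hy hV0)
      simp [this]
    · have hwv : w y ^ (1 / p') = v y := by
        rw [hw, ← ENNReal.rpow_mul, mul_one_div_cancel hp'0.ne', ENNReal.rpow_one]
      have hcancel : prim w y ^ (1 / p' * (1 / p)) * prim w y ^ (-(1 / p) * (1 / p')) = 1 := by
        rw [← ENNReal.rpow_add _ _ hV0 (hfin y).ne, ← ENNReal.rpow_zero (x := prim w y)]
        congr 1
        ring
      rw [ENNReal.mul_rpow_of_nonneg _ _ (by positivity),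
        ENNReal.mul_rpow_of_nonneg _ _ (by positivity), hwv, ← ENNReal.rpow_mul (f y),
        ← ENNReal.rpow_mul (prim w y), ← ENNReal.rpow_mul (prim w y), mul_one_div_cancel hp0.ne',
        ENNReal.rpow_one]
      generalize prim w y ^ (1 / p' * (1 / p)) = X at *
      generalize prim w y ^ (-(1 / p) * (1 / p')) = Y at *
      calc f y * v y = f y * v y * (X * Y) := by rw [hcancel, mul_one]
        _ ≤ f y * X * (Y * v y) := le_of_eq (by ring)
  have hexp : 1 / p' * p = p - 1 := by
    rw [← hone]
    field_simp
  calc (prim (fun y => f y * v y) t / prim w t) ^ p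
      ≤ (A ^ (1 / p) * (prim w t ^ (1 / p') * ENNReal.ofReal p') ^ (1 / p') / prim w t) ^ p := by
        gcongr
    _ = ENNReal.ofReal p' ^ (p - 1) * (A * prim w t ^ (-1 - 1 / p')) := by
        rw [div_eq_mul_inv, ← ENNReal.rpow_neg_one (prim w t),
          ENNReal.mul_rpow_of_nonneg _ _ hp0.le, ENNReal.mul_rpow_of_nonneg _ _ hp0.le,
          ← ENNReal.rpow_mul, ← ENNReal.rpow_mul, ← ENNReal.rpow_mul,
          one_div_mul_cancel hp0.ne', ENNReal.rpow_one, hexp,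
          ENNReal.mul_rpow_of_nonneg _ _ (by linarith), ← ENNReal.rpow_mul]
        have : (-1 - 1 / p') = 1 / p' * (p - 1) + -1 * p := by
          rw [mul_sub, hexp]; ring
        rw [this, ENNReal.rpow_add _ _ h0 (hfin t).ne]
        ring

/-- Hardy's averaging inequality with respect to the measure `v^{p'} dt`. -/
lemma lintegral_prim_div_rpow_mul_le {p p' : ℝ} (hpp : p.HolderConjugate p') {f v : ℝ → ℝ≥0∞}
    (hf : Measurable f) (hv : Measurable v) (hfin : ∀ T, prim (fun y => v y ^ p') T < ⊤) :
    ∫⁻ t in Ioi (0:ℝ), (prim (fun y => f y * v y) t / prim (fun y => v y ^ p') t) ^ p * v t ^ p'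
      ≤ ENNReal.ofReal p' ^ p * ∫⁻ t in Ioi (0:ℝ), f t ^ p := by
  have hp'0 := hpp.symm.pos
  have hp1 := hpp.lt
  set w : ℝ → ℝ≥0∞ := fun y => v y ^ p' with hw
  have hwm : Measurable w := hv.pow_const _
  have hVm := measurable_prim w
  have ham : Measurable fun y => f y ^ p * prim w y ^ (1 / p') := by fun_prop
  have hbm : Measurable fun t => prim w t ^ (-1 - 1 / p') * w t := by fun_prop
  have hp'ne : ENNReal.ofReal p' ≠ 0 := by simpa using hp'0
  calc ∫⁻ t in Ioi (0:ℝ), (prim (fun y => f y * v y) t / prim w t) ^ p * w t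
      ≤ ∫⁻ t in Ioi (0:ℝ), ENNReal.ofReal p' ^ (p - 1) * ((prim w t ^ (-1 - 1 / p') * w t) *
          prim (fun y => f y ^ p * prim w y ^ (1 / p')) t) := by
        refine lintegral_mono fun t => ?_
        refine (mul_le_mul_left (prim_div_rpow_le hpp hf hv hfin t) _).trans_eq ?_
        ring
    _ = ENNReal.ofReal p' ^ (p - 1) * ∫⁻ y in Ioi (0:ℝ), (f y ^ p * prim w y ^ (1 / p')) *
          ∫⁻ t in Ioi y, prim w t ^ (-1 - 1 / p') * w t := by
        rw [lintegral_const_mul _ (by fun_prop), lintegral_mul_lintegral_Ioi ham hbm]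
    _ ≤ ENNReal.ofReal p' ^ (p - 1) * ∫⁻ y in Ioi (0:ℝ), ENNReal.ofReal p' * f y ^ p := by
        refine mul_le_mul_right ?_ _
        refine setLIntegral_mono' measurableSet_Ioi fun y hy => ?_
        have h1 := lintegral_Ioi_prim_rpow_mul_le hwm hfin hy (one_div_pos.2 hp'0)
        rw [one_div_one_div] at h1
        refine (mul_le_mul_right h1 _).trans ?_
        calc f y ^ p * prim w y ^ (1 / p') * (prim w y ^ (-(1 / p')) * ENNReal.ofReal p')
            = ENNReal.ofReal p' * f y ^ p * (prim w y ^ (1 / p') * (prim w y ^ (1 / p'))⁻¹) := by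
              rw [ENNReal.rpow_neg]; ring
          _ ≤ ENNReal.ofReal p' * f y ^ p * 1 := by
              gcongr
              exact ENNReal.mul_inv_le_one _
          _ = _ := mul_one _
    _ = ENNReal.ofReal p' ^ p * ∫⁻ t in Ioi (0:ℝ), f t ^ p := by
        rw [lintegral_const_mul _ (by fun_prop), ← mul_assoc]
        congr 1
        nth_rewrite 2 [← ENNReal.rpow_one (ENNReal.ofReal p')]
        rw [← ENNReal.rpow_add _ _ hp'ne ENNReal.ofReal_ne_top, sub_add_cancel]

/-- The `r`-th power of the constant `B`, for an extended non-negative weight. -/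
def weightInt (lam p' q q' r : ℝ) (v : ℝ → ℝ≥0∞) : ℝ≥0∞ :=
  ∫⁻ t in Ioi (0:ℝ), ENNReal.ofReal t ^ (-(lam * r / q)) *
    prim (fun y => v y ^ p') t ^ (r / q') * v t ^ p'

lemma lintegral_eLap_mul_rpow_le {lam p p' q q' r : ℝ} (hlam : 0 < lam) (hq : 1 < q) (hqp : q < p)
    (hpp : p.HolderConjugate p') (hqq : q.HolderConjugate q') (hr : r = p * q / (p - q))
    {f v : ℝ → ℝ≥0∞} (hf : Measurable f) (hv : Measurable v)
    (hfin : ∀ T, prim (fun y => v y ^ p') T < ⊤) (hfp : ∫⁻ t in Ioi (0:ℝ), f t ^ p < ⊤) :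
    ∫⁻ x in Ioi (0:ℝ), eLap lam (fun y => f y * v y) x ^ q
      ≤ ENNReal.ofReal q * (ENNReal.ofReal p' ^ p) ^ ((q - 1) / p) *
        (∫⁻ t in Ioi (0:ℝ), f t ^ p) ^ (q / p) * weightInt lam p' q q' r v ^ (q / r) := by
  have hp0 := hpp.pos
  have hp'0 := hpp.symm.pos
  have hq0 := hqq.pos
  have hq'0 := hqq.symm.pos
  have hpq : 0 < p - q := by linarith
  have hr0 : 0 < r := by rw [hr]; positivity
  have hqr : q / r = 1 - q / p := by rw [hr]; field_simp
  have hqr0 : 0 < q / r := by positivity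
  set w : ℝ → ℝ≥0∞ := fun y => v y ^ p' with hw
  have hwm : Measurable w := hv.pow_const _
  set F := prim (fun y => f y * v y) with hF
  have hgm : Measurable fun y => f y * v y := hf.mul hv
  have hFm : Measurable F := measurable_prim _
  have hFle : ∀ t, F t ≤ (∫⁻ t in Ioi (0:ℝ), f t ^ p) ^ (1 / p) * prim w t ^ (1 / p') := by
    intro t
    refine (prim_mul_le hpp hf hv t).trans ?_
    gcongr
    exact lintegral_mono_set Ioo_subset_Ioi_self
  have hFfin : ∀ t, F t < ⊤ := fun t => (hFle t).trans_lt (ENNReal.mul_lt_top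
    (ENNReal.rpow_lt_top_of_nonneg (by positivity) hfp.ne)
    (ENNReal.rpow_lt_top_of_nonneg (by positivity) (hfin t).ne))
  have hinv : 1 / p + 1 / p' = 1 := by simpa using hpp.inv_add_inv_eq_one
  have hqinv : 1 / q + 1 / q' = 1 := by simpa using hqq.inv_add_inv_eq_one
  have hpt : ∀ y ∈ Ioi (0:ℝ), ENNReal.ofReal y ^ (-lam) * (F y ^ (q - 1) * (f y * v y))
      ≤ ∏ i : Fin 3, (![fun y => f y ^ p, fun y => (F y / prim w y) ^ p * w y,
          fun y => ENNReal.ofReal y ^ (-(lam * r / q)) * prim w y ^ (r / q') * w y] i y) ^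
          (![1 / p, (q - 1) / p, q / r] i) := by
    intro y _
    simp only [Fin.prod_univ_three, Matrix.cons_val]
    rcases eq_or_ne (prim w y) 0 with hV0 | hV0
    · have : F y = 0 := by
        refine le_antisymm ((hFle y).trans ?_) bot_le
        rw [hV0, ENNReal.zero_rpow_of_pos (by positivity), mul_zero]
      rw [this, ENNReal.zero_rpow_of_pos (by linarith)]
      simp
    · rw [ENNReal.mul_rpow_of_nonneg _ _ (by apply div_nonneg <;> linarith),
        ENNReal.mul_rpow_of_nonneg _ _ hqr0.le, ENNReal.mul_rpow_of_nonneg _ _ hqr0.le,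
        ← ENNReal.rpow_mul (f y), ← ENNReal.rpow_mul (F y / _),
        ← ENNReal.rpow_mul (ENNReal.ofReal y), ← ENNReal.rpow_mul (prim w y)]
      have e1 : p * (1 / p) = 1 := by field_simp
      have e2 : p * ((q - 1) / p) = q - 1 := by field_simp
      have e3 : -(lam * r / q) * (q / r) = -lam := by field_simp
      have e4 : r / q' * (q / r) = q - 1 := by
        have : q' = q / (q - 1) := hqq.conjugate_eq
        have h1 : q - 1 ≠ 0 := by linarith
        rw [this]; field_simp
      have e5 : p' * ((q - 1) / p) + p' * (q / r) = 1 := by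
        have : p' = p / (p - 1) := hpp.conjugate_eq
        have h1 : p - 1 ≠ 0 := by linarith
        rw [hqr, this]; field_simp; ring
      rw [e1, e2, e3, e4, ENNReal.rpow_one, ENNReal.div_rpow_of_nonneg _ _ (by linarith),
        show w y = v y ^ p' from rfl, ← ENNReal.rpow_mul, ← ENNReal.rpow_mul]
      have hv1 : v y = v y ^ (p' * ((q - 1) / p)) * v y ^ (p' * (q / r)) := by
        rw [← ENNReal.rpow_add_of_nonneg, e5, ENNReal.rpow_one]
        · apply mul_nonneg hp'0.le; apply div_nonneg <;> linarith
        · positivity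
      have hVq : prim w y ^ (q - 1) ≠ 0 := by
        simp [ENNReal.rpow_eq_zero_iff, hV0, (hfin y).ne]
      have hVq' : prim w y ^ (q - 1) ≠ ⊤ :=
        ENNReal.rpow_ne_top_of_nonneg (by linarith) (hfin y).ne
      have hF1 : F y ^ (q - 1) = F y ^ (q - 1) / prim w y ^ (q - 1) * prim w y ^ (q - 1) :=
        (ENNReal.div_mul_cancel hVq hVq').symm
      apply le_of_eq
      nth_rewrite 1 [hF1, hv1]
      ring
  have hprod := ENNReal.lintegral_prod_norm_pow_le (μ := volume.restrict (Ioi (0:ℝ)))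
    (Finset.univ : Finset (Fin 3))
    (f := ![fun y => f y ^ p, fun y => (F y / prim w y) ^ p * w y,
          fun y => ENNReal.ofReal y ^ (-(lam * r / q)) * prim w y ^ (r / q') * w y])
    (p := ![1 / p, (q - 1) / p, q / r])
    (by
      intro i _
      fin_cases i
      · exact (hf.pow_const p).aemeasurable
      · exact (((hFm.div (measurable_prim w)).pow_const p).mul hwm).aemeasurable
      · refine Measurable.aemeasurable (Measurable.mul ?_ hwm)
        fun_prop)
    (by
      simp only [Fin.sum_univ_three, Matrix.cons_val]
      rw [hqr]; field_simp; ring)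
    (by
      intro i _
      fin_cases i
      · exact (one_div_pos.2 hp0).le
      · exact div_nonneg (by linarith) hp0.le
      · exact hqr0.le)
  rw [Fin.prod_univ_three] at hprod
  simp only [Matrix.cons_val] at hprod
  refine (lintegral_eLap_rpow_le hlam hq hgm hFfin).trans ?_
  rw [mul_assoc, mul_assoc]
  refine mul_le_mul_right ?_ _
  refine (setLIntegral_mono' measurableSet_Ioi hpt).trans (hprod.trans ?_)
  rw [← mul_assoc]
  refine mul_le_mul_left ?_ _
  calc (∫⁻ a in Ioi (0:ℝ), f a ^ p) ^ (1 / p) *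
        (∫⁻ a in Ioi (0:ℝ), (F a / prim w a) ^ p * w a) ^ ((q - 1) / p)
      ≤ (∫⁻ a in Ioi (0:ℝ), f a ^ p) ^ (1 / p) *
        (ENNReal.ofReal p' ^ p * ∫⁻ t in Ioi (0:ℝ), f t ^ p) ^ ((q - 1) / p) := by
        refine mul_le_mul_right (ENNReal.rpow_le_rpow ?_ (div_nonneg (by linarith) hp0.le)) _
        exact lintegral_prim_div_rpow_mul_le hpp hf hv hfin
    _ = _ := by
        rw [ENNReal.mul_rpow_of_nonneg _ _ (div_nonneg (by linarith) hp0.le), mul_left_comm,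
          ← ENNReal.rpow_add_of_nonneg _ _ (by positivity) (div_nonneg (by linarith) hp0.le)]
        congr 3
        field_simp
        ring

lemma eN_eq_eLpNorm {q : ℝ} (hq : 0 < q) (g : ℝ → ℝ) :
    eN q g = eLpNorm g (ENNReal.ofReal q) (volume.restrict (Ioi (0:ℝ))) := by
  rw [eLpNorm_eq_lintegral_rpow_enorm_toReal (by simpa using hq) ENNReal.ofReal_ne_top,
    ENNReal.toReal_ofReal hq.le]
  simp only [eN, Real.enorm_eq_ofReal_abs]

lemma eN_const_mul {q : ℝ} (hq : 0 < q) (c : ℝ) (g : ℝ → ℝ) :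
    eN q (fun x => c * g x) = ENNReal.ofReal |c| * eN q g := by
  rw [eN_eq_eLpNorm hq, eN_eq_eLpNorm hq, ← Real.enorm_eq_ofReal_abs, ← eLpNorm_const_smul]
  rfl

lemma eN_add_le {q : ℝ} (hq : 1 ≤ q) {g h : ℝ → ℝ} (hg : Measurable g) (hh : Measurable h) :
    eN q (fun x => g x + h x) ≤ eN q g + eN q h := by
  have hq0 : 0 < q := by linarith
  rw [eN_eq_eLpNorm hq0, eN_eq_eLpNorm hq0, eN_eq_eLpNorm hq0]
  exact eLpNorm_add_le hg.aestronglyMeasurable hh.aestronglyMeasurable (by simpa using hq)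

lemma measurable_Lap (lam : ℝ) {v f : ℝ → ℝ} (hv : Measurable v) (hf : Measurable f) :
    Measurable (Lap lam v f) := by
  refine StronglyMeasurable.measurable (StronglyMeasurable.integral_prod_right ?_)
  refine Measurable.stronglyMeasurable ?_
  unfold Function.uncurry
  fun_prop

lemma Lap_const_mul (lam : ℝ) (v f : ℝ → ℝ) (c x : ℝ) :
    Lap lam v (fun y => c * f y) x = c * Lap lam v f x := by
  rw [Lap, Lap, ← integral_const_mul]
  congr 1
  ext y
  ring

lemma LapCompact.eN_lt_top {lam p q : ℝ} (hp : 0 < p) (hq : 0 < q) {v : ℝ → ℝ}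
    (h : LapCompact lam p q v) {f : ℝ → ℝ} (hf : Measurable f) (hf1 : eN p f ≤ 1) :
    eN q (Lap lam v f) < ⊤ := by
  by_contra htop
  rw [not_lt, top_le_iff] at htop
  obtain ⟨φ, hφ, hc⟩ := h (fun n y => (1 / ((n:ℝ) + 1)) * f y) (fun n => hf.const_mul _) (by
    intro n
    rw [eN_const_mul hp]
    refine mul_le_one' ?_ hf1
    rw [ENNReal.ofReal_le_one, abs_of_pos Nat.one_div_pos_of_nat, div_le_one (by positivity)]
    simp)
  obtain ⟨N, hN⟩ := hc 1 one_pos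
  have h1 := hN N le_rfl (N + 1) N.le_succ
  have hne : (1 / ((φ N : ℝ) + 1)) - 1 / ((φ (N + 1) : ℝ) + 1) ≠ 0 :=
    (sub_pos.2 (Nat.one_div_lt_one_div (hφ N.lt_succ_self))).ne'
  have h2 : (fun x => Lap lam v (fun y => (1 / ((φ N : ℝ) + 1)) * f y) x
      - Lap lam v (fun y => (1 / ((φ (N + 1) : ℝ) + 1)) * f y) x)
      = fun x => ((1 / ((φ N : ℝ) + 1)) - 1 / ((φ (N + 1) : ℝ) + 1)) * Lap lam v f x := by
    ext x
    rw [Lap_const_mul, Lap_const_mul, sub_mul]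
  rw [h2, eN_const_mul hq, htop, ENNReal.mul_top (by simpa using hne)] at h1
  exact not_top_lt h1

/-- A compact operator is bounded. -/
lemma LapCompact.exists_bound {lam p q : ℝ} (hp : 0 < p) (hq : 1 ≤ q) {v : ℝ → ℝ}
    (hv : Measurable v) (h : LapCompact lam p q v) :
    ∃ C : ℝ≥0∞, C < ⊤ ∧ ∀ f, Measurable f → eN p f ≤ 1 → eN q (Lap lam v f) ≤ C := by
  by_contra! hcon
  choose f hfm hf1 hfC using fun n : ℕ => hcon n (ENNReal.natCast_lt_top n)
  obtain ⟨φ, hφ, hc⟩ := h f hfm hf1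
  obtain ⟨N, hN⟩ := hc 1 one_pos
  have hfin := h.eN_lt_top hp (by linarith) (hfm (φ N)) (hf1 (φ N))
  have hbd : ∀ m, N ≤ m → eN q (Lap lam v (f (φ m))) ≤ 1 + eN q (Lap lam v (f (φ N))) := by
    intro m hm
    have h1 := eN_add_le hq ((measurable_Lap lam hv (hfm (φ m))).sub
      (measurable_Lap lam hv (hfm (φ N)))) (measurable_Lap lam hv (hfm (φ N)))
    simp only [Pi.sub_apply, sub_add_cancel] at h1
    refine h1.trans (add_le_add_left ?_ _)
    exact (hN m hm N le_rfl).le.trans_eq ENNReal.ofReal_one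
  obtain ⟨K, hK⟩ := ENNReal.exists_nat_gt (ENNReal.add_lt_top.2 ⟨ENNReal.one_lt_top, hfin⟩).ne
  have h1 := hbd (max N K) (le_max_left _ _)
  have h2 := hfC (φ (max N K))
  have h3 : (K : ℝ≥0∞) ≤ (φ (max N K) : ℕ) :=
    Nat.cast_le.2 ((le_max_right N K).trans (hφ.id_le _))
  exact absurd (h3.trans_lt (h2.trans_le h1)) (not_lt.2 hK.le)

lemma lintegral_eLap_rpow_le_of_bound {lam p q : ℝ} (hp : 0 < p) (hq : 0 < q) {v : ℝ → ℝ}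
    (hv : Measurable v) (hvpos : ∀ y, 0 ≤ v y) {C : ℝ≥0∞}
    (hC : ∀ f, Measurable f → eN p f ≤ 1 → eN q (Lap lam v f) ≤ C) {g : ℝ → ℝ≥0∞}
    (hg : Measurable g) (hgfin : ∀ y, g y ≠ ⊤) (hg1 : ∫⁻ y in Ioi (0:ℝ), g y ^ p ≤ 1)
    (hint : ∫⁻ y in Ioi (0:ℝ), g y * ENNReal.ofReal (v y) ≠ ⊤) :
    ∫⁻ x in Ioi (0:ℝ), eLap lam (fun y => g y * ENNReal.ofReal (v y)) x ^ q ≤ C ^ q := by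
  have hfm : Measurable fun y => (g y).toReal := hg.ennreal_toReal
  have hf1 : eN p (fun y => (g y).toReal) ≤ 1 := by
    have : ∀ y, ENNReal.ofReal |(g y).toReal| = g y := fun y => by
      rw [abs_of_nonneg ENNReal.toReal_nonneg, ENNReal.ofReal_toReal (hgfin y)]
    simp only [eN, this]
    exact ENNReal.rpow_le_one hg1 (by positivity)
  have hL := hC _ hfm hf1
  have heq : ∀ x ∈ Ioi (0:ℝ), ENNReal.ofReal |Lap lam v (fun y => (g y).toReal) x| ^ q
      = eLap lam (fun y => g y * ENNReal.ofReal (v y)) x ^ q := by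
    intro x hx
    have hx0 : (0:ℝ) < x := hx
    have hfin : eLap lam (fun y => g y * ENNReal.ofReal (v y)) x ≠ ⊤ := by
      refine ne_top_of_le_ne_top hint (setLIntegral_mono' measurableSet_Ioi fun y hy => ?_)
      have hy0 : (0:ℝ) < y := hy
      refine mul_le_of_le_one_left bot_le ?_
      rw [ENNReal.ofReal_le_one, Real.exp_le_one_iff, neg_nonpos]
      positivity
    have h1 : Lap lam v (fun y => (g y).toReal) x
        = (eLap lam (fun y => g y * ENNReal.ofReal (v y)) x).toReal := by
      rw [Lap, integral_eq_lintegral_of_nonneg_ae]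
      · congr 1
        refine lintegral_congr fun y => ?_
        rw [mul_assoc, ENNReal.ofReal_mul (Real.exp_pos _).le,
          ENNReal.ofReal_mul ENNReal.toReal_nonneg, ENNReal.ofReal_toReal (hgfin y)]
      · exact .of_forall fun y => mul_nonneg (mul_nonneg (Real.exp_pos _).le
          ENNReal.toReal_nonneg) (hvpos y)
      · refine Measurable.aestronglyMeasurable ?_
        fun_prop
    rw [h1, abs_of_nonneg ENNReal.toReal_nonneg, ENNReal.ofReal_toReal hfin]
  rw [eN, setLIntegral_congr_fun measurableSet_Ioi heq] at hL
  have := ENNReal.rpow_le_rpow hL hq.le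
  rwa [← ENNReal.rpow_mul, one_div_mul_cancel hq.ne', ENNReal.rpow_one] at this

/-- Tonelli's theorem on the region `0 < y < x^{-1/λ}`. -/
lemma lintegral_rpow_mul_prim {lam s : ℝ} (hlam : 0 < lam) (hs : -1 < s) {a : ℝ → ℝ≥0∞}
    (ha : Measurable a) :
    ∫⁻ x in Ioi (0:ℝ), ENNReal.ofReal x ^ s * prim a (x ^ (-(1 / lam)))
      = ENNReal.ofReal (1 / (s + 1)) *
        ∫⁻ y in Ioi (0:ℝ), ENNReal.ofReal y ^ (-(lam * (s + 1))) * a y := by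
  have hset : MeasurableSet {z : ℝ × ℝ | z.2 < z.1 ^ (-(1 / lam))} :=
    measurableSet_lt measurable_snd (by fun_prop)
  have hm : Measurable (Function.uncurry fun x y : ℝ =>
      {z : ℝ × ℝ | z.2 < z.1 ^ (-(1 / lam))}.indicator
        (fun z => ENNReal.ofReal z.1 ^ s * a z.2) (x, y)) := by
    simp only [Function.uncurry_def]
    refine Measurable.indicator ?_ hset
    fun_prop
  have h1 : ∀ x ∈ Ioi (0:ℝ), ENNReal.ofReal x ^ s * prim a (x ^ (-(1 / lam)))
      = ∫⁻ y in Ioi (0:ℝ), {z : ℝ × ℝ | z.2 < z.1 ^ (-(1 / lam))}.indicator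
        (fun z => ENNReal.ofReal z.1 ^ s * a z.2) (x, y) := by
    intro x _
    rw [prim, ← lintegral_const_mul _ ha, ← lintegral_indicator measurableSet_Ioi,
      ← lintegral_indicator measurableSet_Ioo]
    refine lintegral_congr fun y => ?_
    simp only [indicator, mem_Ioi, mem_Ioo, mem_ofPred_eq]
    by_cases h1 : 0 < y <;> by_cases h2 : y < x ^ (-(1 / lam)) <;>
      simp only [h1, h2, and_true, and_false, if_true, if_false]
  have h2 : ∀ y ∈ Ioi (0:ℝ), ∫⁻ x in Ioi (0:ℝ),
      {z : ℝ × ℝ | z.2 < z.1 ^ (-(1 / lam))}.indicator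
        (fun z => ENNReal.ofReal z.1 ^ s * a z.2) (x, y)
      = ENNReal.ofReal (1 / (s + 1)) * (ENNReal.ofReal y ^ (-(lam * (s + 1))) * a y) := by
    intro y hy
    have hy0 : (0:ℝ) < y := hy
    have h3 : ∀ x : ℝ, (Ioi (0:ℝ)).indicator (fun x =>
        {z : ℝ × ℝ | z.2 < z.1 ^ (-(1 / lam))}.indicator
        (fun z => ENNReal.ofReal z.1 ^ s * a z.2) (x, y)) x
        = (Ioo 0 (y ^ (-lam))).indicator (fun x => ENNReal.ofReal x ^ s * a y) x := by
      intro x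
      simp only [indicator, mem_Ioi, mem_Ioo, mem_ofPred_eq]
      by_cases hx : 0 < x
      · have : y < x ^ (-(1 / lam)) ↔ x < y ^ (-lam) := by
          rw [← Real.lt_rpow_inv_iff_of_neg hy0 hx (by simpa using hlam)]
          simp [inv_neg]
        simp only [hx, this, true_and, if_true]
      · simp [hx]
    rw [← lintegral_indicator measurableSet_Ioi, lintegral_congr h3,
      lintegral_indicator measurableSet_Ioo, lintegral_mul_const _ (by fun_prop),
      lintegral_Ioo_rpow hs (by positivity), div_eq_mul_one_div,
      ENNReal.ofReal_mul (by positivity), ← Real.rpow_mul hy0.le,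
      ← ENNReal.ofReal_rpow_of_pos hy0]
    rw [neg_mul]
    ring
  rw [setLIntegral_congr_fun measurableSet_Ioi h1, lintegral_lintegral_swap hm.aemeasurable,
    setLIntegral_congr_fun measurableSet_Ioi h2, lintegral_const_mul _ (by fun_prop)]

lemma prim_le_eLap {lam x : ℝ} (hlam : 0 < lam) (hx : 0 < x) {g : ℝ → ℝ≥0∞} (hg : Measurable g) :
    ENNReal.ofReal (Real.exp (-1)) * prim g (x ^ (-(1 / lam))) ≤ eLap lam g x := by
  rw [prim, ← lintegral_const_mul _ hg]
  refine (setLIntegral_mono' measurableSet_Ioo fun y hy => ?_).trans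
    (lintegral_mono_set Ioo_subset_Ioi_self)
  refine mul_le_mul_left (ENNReal.ofReal_le_ofReal (Real.exp_le_exp.2 ?_)) _
  have h1 : y ^ lam ≤ (x ^ (-(1 / lam))) ^ lam := Real.rpow_le_rpow hy.1.le hy.2.le hlam.le
  rw [← Real.rpow_mul hx.le, neg_mul, one_div_mul_cancel hlam.ne', Real.rpow_neg_one] at h1
  have h2 : x * y ^ lam ≤ x * x⁻¹ := mul_le_mul_of_nonneg_left h1 hx.le
  rw [mul_inv_cancel₀ hx.ne'] at h2
  linarith

/-- The extremal function `t^{-λr/(pq)} V^{r/(pq')} v^{p'/p}` for the Laplace transform. -/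
def testFun (lam p p' q q' r : ℝ) (v : ℝ → ℝ≥0∞) (t : ℝ) : ℝ≥0∞ :=
  ENNReal.ofReal t ^ (-(lam * r / q) / p) * prim (fun y => v y ^ p') t ^ (r / q' / p) *
    v t ^ (p' / p)

lemma measurable_testFun (lam p p' q q' r : ℝ) {v : ℝ → ℝ≥0∞} (hv : Measurable v) :
    Measurable (testFun lam p p' q q' r v) := by
  unfold testFun
  fun_prop

lemma lintegral_testFun_rpow {lam p p' q q' r : ℝ} (hp : 0 < p) {v : ℝ → ℝ≥0∞} :
    ∫⁻ t in Ioi (0:ℝ), testFun lam p p' q q' r v t ^ p = weightInt lam p' q q' r v := by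
  refine lintegral_congr fun t => ?_
  rw [testFun, ENNReal.mul_rpow_of_nonneg _ _ hp.le, ENNReal.mul_rpow_of_nonneg _ _ hp.le,
    ← ENNReal.rpow_mul, ← ENNReal.rpow_mul, ← ENNReal.rpow_mul, div_mul_cancel₀ _ hp.ne',
    div_mul_cancel₀ _ hp.ne', div_mul_cancel₀ _ hp.ne']

lemma rpow_mul_prim_le_prim_testFun {lam p p' q q' r : ℝ} (hlam : 0 < lam) (hq : 0 < q)
    (hq' : 0 < q') (hr : 0 < r) (hpp : p.HolderConjugate p') {v : ℝ → ℝ≥0∞} (hv : Measurable v)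
    {t : ℝ} (hfin : prim (fun y => v y ^ p') t < ⊤) :
    ENNReal.ofReal t ^ (-(lam * r / q) / p) *
        (prim (fun y => v y ^ p') t ^ (r / q' / p + 1) * ENNReal.ofReal (1 / (r / q' / p + 1)))
      ≤ prim (fun y => testFun lam p p' q q' r v y * v y) t := by
  have hp0 := hpp.pos
  have hp'0 := hpp.symm.pos
  have hs : 0 < r / q' / p := by positivity
  rw [← lintegral_prim_rpow_mul (hv.pow_const p') hfin (by linarith), prim,
    ← lintegral_const_mul _ (by fun_prop)]
  refine setLIntegral_mono' measurableSet_Ioo fun y hy => ?_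
  have hvv : v y ^ p' = v y ^ (p' / p) * v y := by
    nth_rewrite 3 [← ENNReal.rpow_one (v y)]
    rw [← ENNReal.rpow_add_of_nonneg _ _ (by positivity) zero_le_one]
    congr 1
    have := hpp.conjugate_eq
    have h1 : p - 1 ≠ 0 := by linarith [hpp.lt]
    rw [this]; field_simp; ring
  have hle : ENNReal.ofReal t ^ (-(lam * r / q) / p) ≤ ENNReal.ofReal y ^ (-(lam * r / q) / p) := by
    rw [neg_div, ENNReal.rpow_neg, ENNReal.rpow_neg, ENNReal.inv_le_inv]
    exact ENNReal.rpow_le_rpow (ENNReal.ofReal_le_ofReal hy.2.le) (by positivity)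
  refine (mul_le_mul_left hle _).trans_eq ?_
  simp only [testFun]
  nth_rewrite 1 [hvv]
  ring

/-- Lower bound for the Laplace transform of the extremal function. -/
lemma weightInt_le_lintegral_eLap {lam p p' q q' r : ℝ} (hlam : 0 < lam) (hqp : q < p)
    (hpp : p.HolderConjugate p') (hqq : q.HolderConjugate q') (hr : r = p * q / (p - q)) :
    ∃ c : ℝ≥0∞, c ≠ 0 ∧ c ≠ ⊤ ∧ ∀ v : ℝ → ℝ≥0∞, Measurable v →
      (∀ T, prim (fun y => v y ^ p') T < ⊤) →
      c * weightInt lam p' q q' r v ≤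
        ∫⁻ x in Ioi (0:ℝ), eLap lam (fun y => testFun lam p p' q q' r v y * v y) x ^ q := by
  have hp0 := hpp.pos
  have hq0 := hqq.pos
  have hq'0 := hqq.symm.pos
  have hpq : 0 < p - q := by linarith
  have hr0 : 0 < r := by rw [hr]; positivity
  have hrp : r / p + 1 = r / q := by rw [hr]; field_simp; ring
  have hsq : (r / q' / p + 1) * q = r / q' + 1 := by
    have h1 : q - 1 ≠ 0 := by linarith [hqq.lt]
    rw [hr, hqq.conjugate_eq]; field_simp; ring
  have hk0 : 0 < r / q' + 1 := by positivity
  set c₁ : ℝ≥0∞ := ENNReal.ofReal (Real.exp (-1)) * ENNReal.ofReal (1 / (r / q' / p + 1)) with hc₁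
  have hc₁0 : c₁ ≠ 0 := by
    refine mul_ne_zero ?_ ?_
    · simpa using Real.exp_pos _
    · rw [Ne, ENNReal.ofReal_eq_zero, not_le]; positivity
  have hc₁t : c₁ ≠ ⊤ := ENNReal.mul_ne_top ENNReal.ofReal_ne_top ENNReal.ofReal_ne_top
  refine ⟨c₁ ^ q * ENNReal.ofReal (r / q' + 1) * ENNReal.ofReal (1 / (r / p + 1)), ?_, ?_, ?_⟩
  · refine mul_ne_zero (mul_ne_zero ?_ ?_) ?_
    · simp [ENNReal.rpow_eq_zero_iff, hc₁0, hc₁t]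
    · rw [Ne, ENNReal.ofReal_eq_zero, not_le]; positivity
    · rw [Ne, ENNReal.ofReal_eq_zero, not_le]; positivity
  · exact ENNReal.mul_ne_top (ENNReal.mul_ne_top (ENNReal.rpow_ne_top_of_nonneg hq0.le hc₁t)
      ENNReal.ofReal_ne_top) ENNReal.ofReal_ne_top
  intro v hv hfin
  set w : ℝ → ℝ≥0∞ := fun y => v y ^ p' with hw
  have hwm : Measurable w := hv.pow_const _
  have ham : Measurable fun y => prim w y ^ (r / q') * w y := by fun_prop
  have hT := lintegral_rpow_mul_prim (lam := lam) (s := r / p) hlam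
    (by linarith [div_pos hr0 hp0]) ham
  have hW : weightInt lam p' q q' r v = ∫⁻ y in Ioi (0:ℝ),
      ENNReal.ofReal y ^ (-(lam * (r / p + 1))) * (prim w y ^ (r / q') * w y) := by
    refine lintegral_congr fun y => ?_
    rw [hrp, mul_div_assoc, mul_assoc]
  rw [mul_assoc, hW, ← hT, ← lintegral_const_mul _ (by fun_prop)]
  refine setLIntegral_mono' measurableSet_Ioi fun x hx => ?_
  have hx0 : (0:ℝ) < x := hx
  set t := x ^ (-(1 / lam)) with ht
  have ht0 : 0 < t := Real.rpow_pos_of_pos hx0 _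
  have hprimpow : prim (fun y => prim w y ^ (r / q') * w y) t
      = prim w t ^ (r / q' + 1) * ENNReal.ofReal (1 / (r / q' + 1)) :=
    lintegral_prim_rpow_mul hwm (hfin t) (by linarith)
  have htx : (ENNReal.ofReal t ^ (-(lam * r / q) / p)) ^ q = ENNReal.ofReal x ^ (r / p) := by
    rw [ht, ← ENNReal.ofReal_rpow_of_pos hx0, ← ENNReal.rpow_mul, ← ENNReal.rpow_mul]
    congr 1
    field_simp
  calc c₁ ^ q * ENNReal.ofReal (r / q' + 1) *
        (ENNReal.ofReal x ^ (r / p) * prim (fun y => prim w y ^ (r / q') * w y) t)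
      = c₁ ^ q * (ENNReal.ofReal x ^ (r / p) * prim w t ^ (r / q' + 1)) := by
        rw [hprimpow]
        have h1 : ENNReal.ofReal (r / q' + 1) * ENNReal.ofReal (1 / (r / q' + 1)) = 1 := by
          rw [← ENNReal.ofReal_mul hk0.le, mul_one_div_cancel hk0.ne', ENNReal.ofReal_one]
        calc _ = c₁ ^ q * (ENNReal.ofReal x ^ (r / p) * prim w t ^ (r / q' + 1)) *
              (ENNReal.ofReal (r / q' + 1) * ENNReal.ofReal (1 / (r / q' + 1))) := by ring
          _ = _ := by rw [h1, mul_one]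
    _ = (ENNReal.ofReal (Real.exp (-1)) * (ENNReal.ofReal t ^ (-(lam * r / q) / p) *
        (prim w t ^ (r / q' / p + 1) * ENNReal.ofReal (1 / (r / q' / p + 1))))) ^ q := by
        rw [← htx, ← hsq, ENNReal.rpow_mul, ← ENNReal.mul_rpow_of_nonneg _ _ hq0.le,
          ← ENNReal.mul_rpow_of_nonneg _ _ hq0.le, hc₁]
        congr 1
        ring
    _ ≤ eLap lam (fun y => testFun lam p p' q q' r v y * v y) x ^ q := by
        refine ENNReal.rpow_le_rpow ?_ hq0.le
        refine (mul_le_mul_right (rpow_mul_prim_le_prim_testFun hlam hq0 hq'0 hr0 hpp hv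
          (hfin t)) _).trans ?_
        exact prim_le_eLap hlam hx0 ((measurable_testFun _ _ _ _ _ _ hv).mul hv)

lemma iUnion_Ioo_one_div_succ : ⋃ n : ℕ, Ioo (1 / ((n:ℝ) + 1)) ((n:ℝ) + 1) = Ioi (0:ℝ) := by
  ext y
  simp only [mem_iUnion, mem_Ioo, mem_Ioi]
  constructor
  · rintro ⟨n, h1, -⟩
    exact lt_trans (by positivity) h1
  · intro hy
    obtain ⟨n, hn⟩ := exists_nat_one_div_lt hy
    obtain ⟨m, hm⟩ := exists_nat_gt y
    refine ⟨max n m, lt_of_le_of_lt ?_ hn, hm.trans_le ?_⟩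
    · refine one_div_le_one_div_of_le (by positivity) ?_
      have : (n:ℝ) ≤ (max n m : ℕ) := by exact_mod_cast le_max_left n m
      linarith
    · have : (m:ℝ) ≤ (max n m : ℕ) := by exact_mod_cast le_max_right n m
      linarith

lemma monotone_Ioo_one_div_succ : Monotone fun n : ℕ => Ioo (1 / ((n:ℝ) + 1)) ((n:ℝ) + 1) := by
  intro m n hmn
  have : (m:ℝ) ≤ n := by exact_mod_cast hmn
  exact Ioo_subset_Ioo (one_div_le_one_div_of_le (by positivity) (by linarith)) (by linarith)

lemma setLIntegral_Icc_rpow_lt_top {p' : ℝ} (hp' : 0 ≤ p') {v : ℝ → ℝ} (hvpos : ∀ y, 0 ≤ v y)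
    (hloc : LocallyIntegrableOn (fun y => v y ^ p') (Ioi (0:ℝ))) {a b : ℝ} (ha : 0 < a) :
    ∫⁻ y in Icc a b, ENNReal.ofReal (v y) ^ p' < ⊤ := by
  have h := hloc.integrableOn_compact_subset
    (fun y hy => ha.trans_le hy.1 : Icc a b ⊆ Ioi (0:ℝ)) isCompact_Icc
  have h2 := h.lintegral_lt_top
  simp only [← ENNReal.ofReal_rpow_of_nonneg (hvpos _) hp'] at h2
  exact h2

lemma indicator_rpow {p' : ℝ} (hp' : 0 < p') (S : Set ℝ) (v : ℝ → ℝ≥0∞) (y : ℝ) :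
    S.indicator v y ^ p' = S.indicator (fun y => v y ^ p') y := by
  by_cases hy : y ∈ S <;> simp [hp', hy]

/-- A bound on the Laplace transform of the extremal function bounds the truncated weight
integral. -/
lemma weightInt_indicator_le {lam p p' q q' r : ℝ} (hlam : 0 < lam) (hqp : q < p)
    (hpp : p.HolderConjugate p') (hqq : q.HolderConjugate q') (hr : r = p * q / (p - q))
    {v : ℝ → ℝ} (hv : Measurable v) (hvpos : ∀ y, 0 ≤ v y)
    (hloc : LocallyIntegrableOn (fun y => v y ^ p') (Ioi (0:ℝ))) {C : ℝ≥0∞} (hCt : C < ⊤)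
    (hC : ∀ f, Measurable f → eN p f ≤ 1 → eN q (Lap lam v f) ≤ C) :
    ∃ K : ℝ≥0∞, K < ⊤ ∧ ∀ a b : ℝ, 0 < a → weightInt lam p' q q' r
      ((Ioo a b).indicator fun y => ENNReal.ofReal (v y)) ≤ K := by
  obtain ⟨c, hc0, hct, hc⟩ := weightInt_le_lintegral_eLap hlam hqp hpp hqq hr
  have hp0 := hpp.pos
  have hp'0 := hpp.symm.pos
  have hq0 := hqq.pos
  have hq'0 := hqq.symm.pos
  have hpq : 0 < p - q := by linarith
  have hr0 : 0 < r := by rw [hr]; positivity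
  have hθ : 0 < 1 - q / p := by rw [sub_pos, div_lt_one hp0]; exact hqp
  refine ⟨(C ^ q / c) ^ (1 / (1 - q / p)), ?_, fun a b ha => ?_⟩
  · exact ENNReal.rpow_lt_top_of_nonneg (by positivity)
      (ENNReal.div_ne_top (ENNReal.rpow_ne_top_of_nonneg hq0.le hCt.ne) hc0)
  set u : ℝ → ℝ≥0∞ := (Ioo a b).indicator fun y => ENNReal.ofReal (v y) with hu
  have hum : Measurable u := (by fun_prop : Measurable fun y => ENNReal.ofReal (v y)).indicator
    measurableSet_Ioo
  have hwm : Measurable fun y => u y ^ p' := hum.pow_const _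
  have hut : ∀ y, u y ≠ ⊤ := by
    intro y
    by_cases hy : y ∈ Ioo a b <;> simp [hu, hy]
  have hwfin : ∫⁻ y, u y ^ p' < ⊤ := by
    simp only [hu, indicator_rpow hp'0]
    rw [lintegral_indicator measurableSet_Ioo]
    exact (lintegral_mono_set Ioo_subset_Icc_self).trans_lt
      (setLIntegral_Icc_rpow_lt_top hp'0.le hvpos hloc ha)
  have hprim : ∀ T, prim (fun y => u y ^ p') T < ⊤ := fun T =>
    (setLIntegral_le_lintegral _ _).trans_lt hwfin
  set I := weightInt lam p' q q' r u with hI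
  have hIt : I ≠ ⊤ := by
    have hle : I ≤ ∫⁻ t in Ioi (0:ℝ), ENNReal.ofReal a ^ (-(lam * r / q)) *
        (∫⁻ y, u y ^ p') ^ (r / q') * u t ^ p' := by
      refine setLIntegral_mono' measurableSet_Ioi fun t ht => ?_
      by_cases hta : t ∈ Ioo a b
      · refine mul_le_mul_left (mul_le_mul' ?_ ?_) _
        · rw [ENNReal.rpow_neg, ENNReal.rpow_neg, ENNReal.inv_le_inv]
          exact ENNReal.rpow_le_rpow (ENNReal.ofReal_le_ofReal hta.1.le) (by positivity)
        · exact ENNReal.rpow_le_rpow (setLIntegral_le_lintegral _ _) (by positivity)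
      · have : u t = 0 := by simp [hu, hta]
        simp [this, hp'0]
    refine (hle.trans_lt ?_).ne
    rw [lintegral_const_mul _ hwm]
    refine ENNReal.mul_lt_top (ENNReal.mul_lt_top ?_ ?_)
      ((setLIntegral_le_lintegral _ _).trans_lt hwfin)
    · rw [ENNReal.ofReal_rpow_of_pos ha]; exact ENNReal.ofReal_lt_top
    · exact ENNReal.rpow_lt_top_of_nonneg (by positivity) hwfin.ne
  set g := testFun lam p p' q q' r u with hg
  have hgm : Measurable g := measurable_testFun _ _ _ _ _ _ hum
  have hg0 : ∀ y, y ∉ Ioo a b → g y = 0 := by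
    intro y hy
    have : u y = 0 := by simp [hu, hy]
    simp [hg, testFun, this, div_pos hp'0 hp0]
  have hgfin : ∀ y, g y ≠ ⊤ := by
    intro y
    by_cases hy : y ∈ Ioo a b
    · refine ENNReal.mul_ne_top (ENNReal.mul_ne_top ?_ ?_) ?_
      · rw [ENNReal.ofReal_rpow_of_pos (ha.trans hy.1)]; exact ENNReal.ofReal_ne_top
      · exact ENNReal.rpow_ne_top_of_nonneg (by positivity) (hprim y).ne
      · exact ENNReal.rpow_ne_top_of_nonneg (by positivity) (hut y)
    · simp [hg0 y hy]
  have hgv : ∀ y, g y * ENNReal.ofReal (v y) = g y * u y := by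
    intro y
    by_cases hy : y ∈ Ioo a b
    · simp [hu, hy]
    · simp [hg0 y hy]
  have hgp : ∫⁻ y in Ioi (0:ℝ), g y ^ p = I := lintegral_testFun_rpow hp0
  have hgint : ∫⁻ y in Ioi (0:ℝ), g y * u y ≠ ⊤ := by
    refine ((ENNReal.lintegral_mul_le_Lp_mul_Lq (volume.restrict (Ioi (0:ℝ))) hpp
      hgm.aemeasurable hum.aemeasurable).trans_lt ?_).ne
    rw [hgp]
    exact ENNReal.mul_lt_top (ENNReal.rpow_lt_top_of_nonneg (by positivity) hIt)
      (ENNReal.rpow_lt_top_of_nonneg (by positivity)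
        ((setLIntegral_le_lintegral _ _).trans_lt hwfin).ne)
  rcases eq_or_ne I 0 with hI0 | hI0
  · simp [hI0]
  set M := (I ^ (1 / p))⁻¹ with hM
  have hN0 : I ^ (1 / p) ≠ 0 := by simp [ENNReal.rpow_eq_zero_iff, hI0, hIt]
  have hMt : M ≠ ⊤ := ENNReal.inv_ne_top.2 hN0
  have key := lintegral_eLap_rpow_le_of_bound (lam := lam) (g := fun y => M * g y)
    hp0 hq0 hv hvpos hC
    (hgm.const_mul M) (fun y => ENNReal.mul_ne_top hMt (hgfin y)) (by
      simp only [ENNReal.mul_rpow_of_nonneg _ _ hp0.le]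
      rw [lintegral_const_mul _ (hgm.pow_const _), hgp, hM, ENNReal.inv_rpow, ← ENNReal.rpow_mul,
        one_div_mul_cancel hp0.ne', ENNReal.rpow_one, ENNReal.inv_mul_cancel hI0 hIt]) (by
      simp only [mul_assoc, hgv]
      rw [lintegral_const_mul' _ _ hMt]
      exact ENNReal.mul_ne_top hMt hgint)
  have hscale : ∀ x, eLap lam (fun y => M * g y * ENNReal.ofReal (v y)) x
      = M * eLap lam (fun y => g y * u y) x := by
    intro x
    rw [eLap, eLap, ← lintegral_const_mul _ (by fun_prop)]
    refine lintegral_congr fun y => ?_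
    rw [mul_assoc M, hgv]
    ring
  simp only [hscale, ENNReal.mul_rpow_of_nonneg _ _ hq0.le] at key
  have hMq : M ^ q = I ^ (-(q / p)) := by
    rw [hM, ENNReal.inv_rpow, ← ENNReal.rpow_mul, ENNReal.rpow_neg]
    congr 2
    ring
  rw [lintegral_const_mul' _ _ (ENNReal.rpow_ne_top_of_nonneg hq0.le hMt), hMq] at key
  have h1 : I ^ (1 - q / p) * c ≤ C ^ q := by
    refine le_trans (le_of_eq ?_) ((mul_le_mul_right (hc u hum hprim) _).trans key)
    rw [sub_eq_neg_add, ENNReal.rpow_add _ _ hI0 hIt, ENNReal.rpow_one, ← hI]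
    ring
  have h2 := ENNReal.rpow_le_rpow ((ENNReal.le_div_iff_mul_le (Or.inl hc0) (Or.inl hct)).2 h1)
    (by positivity : 0 ≤ 1 / (1 - q / p))
  rwa [← ENNReal.rpow_mul, mul_one_div_cancel hθ.ne', ENNReal.rpow_one] at h2

/-- Necessity: a bounded Laplace-type operator has a finite weight integral. -/
lemma weightInt_lt_top_of_bound {lam p p' q q' r : ℝ} (hlam : 0 < lam) (hqp : q < p)
    (hpp : p.HolderConjugate p') (hqq : q.HolderConjugate q') (hr : r = p * q / (p - q))
    {v : ℝ → ℝ} (hv : Measurable v) (hvpos : ∀ y, 0 ≤ v y)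
    (hloc : LocallyIntegrableOn (fun y => v y ^ p') (Ioi (0:ℝ))) {C : ℝ≥0∞} (hCt : C < ⊤)
    (hC : ∀ f, Measurable f → eN p f ≤ 1 → eN q (Lap lam v f) ≤ C) :
    weightInt lam p' q q' r (fun y => ENNReal.ofReal (v y)) < ⊤ := by
  obtain ⟨K, hKt, hK⟩ := weightInt_indicator_le hlam hqp hpp hqq hr hv hvpos hloc hCt hC
  have hp'0 := hpp.symm.pos
  have hq'0 := hqq.symm.pos
  have hr0 : 0 < r := by
    have := hpp.pos
    have := hqq.pos
    have : 0 < p - q := by linarith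
    rw [hr]; positivity
  refine lt_of_le_of_lt ?_ hKt
  set S : ℕ → Set ℝ := fun n => Ioo (1 / ((n:ℝ) + 1)) ((n:ℝ) + 1) with hS
  have hSm : ∀ n, MeasurableSet (S n) := fun n => measurableSet_Ioo
  set u : ℝ → ℝ≥0∞ := fun y => ENNReal.ofReal (v y) with hu
  have hum : Measurable u := by fun_prop
  have hunm : ∀ n, Measurable ((S n).indicator u) := fun n => hum.indicator (hSm n)
  have hev : ∀ y ∈ Ioi (0:ℝ), ∀ᶠ n in atTop, (S n).indicator u y = u y := by
    intro y hy
    rw [← iUnion_Ioo_one_div_succ, mem_iUnion] at hy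
    obtain ⟨N, hN⟩ := hy
    filter_upwards [eventually_ge_atTop N] with n hn
    exact indicator_of_mem (monotone_Ioo_one_div_succ hn hN) _
  have hprimt : ∀ t, Tendsto (fun n => prim (fun y => (S n).indicator u y ^ p') t) atTop
      (𝓝 (prim (fun y => u y ^ p') t)) := by
    intro t
    refine lintegral_tendsto_of_tendsto_of_monotone
      (fun n => ((hunm n).pow_const _).aemeasurable) ?_ ?_
    · refine Eventually.of_forall fun y m n hmn => ENNReal.rpow_le_rpow ?_ hp'0.le
      exact indicator_le_indicator_of_subset (monotone_Ioo_one_div_succ hmn) (by simp) y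
    · filter_upwards [ae_restrict_mem measurableSet_Ioo] with y hy
      refine tendsto_nhds_of_eventually_eq ?_
      filter_upwards [hev y hy.1] with n hn
      rw [hn]
  set F : ℕ → ℝ → ℝ≥0∞ := fun n t => ENNReal.ofReal t ^ (-(lam * r / q)) *
    prim (fun y => (S n).indicator u y ^ p') t ^ (r / q') * (S n).indicator u t ^ p' with hF
  have hFm : ∀ n, Measurable (F n) := by
    intro n
    have h := hunm n
    have h2 : Measurable fun y => (S n).indicator u y ^ p' := h.pow_const _
    simp only [hF]
    fun_prop
  have hle : weightInt lam p' q q' r u ≤ ∫⁻ t in Ioi (0:ℝ), liminf (fun n => F n t) atTop := by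
    refine setLIntegral_mono' measurableSet_Ioi fun t ht => ?_
    have ht0 : (0:ℝ) < t := ht
    have htend : Tendsto (fun n => F n t) atTop (𝓝 (ENNReal.ofReal t ^ (-(lam * r / q)) *
        prim (fun y => u y ^ p') t ^ (r / q') * u t ^ p')) := by
      have h1 : Tendsto (fun n => ENNReal.ofReal t ^ (-(lam * r / q)) *
          prim (fun y => (S n).indicator u y ^ p') t ^ (r / q') * u t ^ p') atTop
          (𝓝 (ENNReal.ofReal t ^ (-(lam * r / q)) *
          prim (fun y => u y ^ p') t ^ (r / q') * u t ^ p')) := by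
        refine ENNReal.Tendsto.mul_const (ENNReal.Tendsto.const_mul
          ((ENNReal.continuous_rpow_const.tendsto _).comp (hprimt t)) (Or.inr ?_)) (Or.inr ?_)
        · rw [ENNReal.ofReal_rpow_of_pos ht0]; exact ENNReal.ofReal_ne_top
        · exact ENNReal.rpow_ne_top_of_nonneg hp'0.le ENNReal.ofReal_ne_top
      refine h1.congr' ?_
      filter_upwards [hev t ht] with n hn
      simp only [hF, hn]
    exact htend.liminf_eq.ge
  refine hle.trans ((lintegral_liminf_le hFm).trans ?_)
  refine liminf_le_of_le (by isBoundedDefault) fun b hb => ?_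
  obtain ⟨n, hn⟩ := hb.exists
  exact hn.trans (hK _ _ (by positivity))

lemma measurable_eLap (lam : ℝ) {g : ℝ → ℝ≥0∞} (hg : Measurable g) : Measurable (eLap lam g) := by
  refine Measurable.lintegral_prod_right ?_
  unfold Function.uncurry
  fun_prop

/-- A finite weight integral forces `v^{p'}` to be integrable near the origin. -/
lemma prim_lt_top_of_weightInt_lt_top {lam p' q q' r : ℝ} (hp' : 0 < p') (hrq : 0 < r / q')
    {v : ℝ → ℝ} (hv : Measurable v) (hvpos : ∀ y, 0 ≤ v y)
    (hloc : LocallyIntegrableOn (fun y => v y ^ p') (Ioi (0:ℝ)))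
    (hW : weightInt lam p' q q' r (fun y => ENNReal.ofReal (v y)) < ⊤) (T : ℝ) :
    prim (fun y => ENNReal.ofReal (v y) ^ p') T < ⊤ := by
  by_contra htop
  rw [not_lt, top_le_iff] at htop
  set w : ℝ → ℝ≥0∞ := fun y => ENNReal.ofReal (v y) ^ p' with hw
  have hwm : Measurable w := by fun_prop
  have hall : ∀ t ∈ Ioi (0:ℝ), prim w t = ⊤ := by
    intro t ht
    by_contra hne
    have hsub : Ioo (0:ℝ) T ⊆ Ioo 0 t ∪ Icc t T := by
      intro y hy
      rcases lt_or_ge y t with h | h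
      · exact Or.inl ⟨hy.1, h⟩
      · exact Or.inr ⟨h, hy.2.le⟩
    have := ((lintegral_mono_set hsub).trans (lintegral_union_le w _ _)).trans_lt
      (ENNReal.add_lt_top.2 ⟨lt_top_iff_ne_top.2 hne,
        setLIntegral_Icc_rpow_lt_top hp'.le hvpos hloc ht⟩)
    exact this.ne htop
  have hae : ∀ᵐ t ∂volume.restrict (Ioi (0:ℝ)), w t = 0 := by
    filter_upwards [ae_lt_top (by fun_prop) hW.ne, ae_restrict_mem measurableSet_Ioi] with t ht ht0
    have ht0' : (0:ℝ) < t := ht0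
    by_contra hwt
    have h1 : ENNReal.ofReal t ^ (-(lam * r / q)) ≠ 0 := by
      rw [ENNReal.ofReal_rpow_of_pos ht0', Ne, ENNReal.ofReal_eq_zero, not_le]
      exact Real.rpow_pos_of_pos ht0' _
    rw [show prim (fun y => ENNReal.ofReal (v y) ^ p') t = ⊤ from hall t ht0,
      ENNReal.top_rpow_of_pos hrq, ENNReal.mul_top h1, ENNReal.top_mul hwt] at ht
    exact lt_irrefl _ ht
  have h0 : prim w T = 0 := by
    refine (lintegral_eq_zero_iff hwm).2 ?_
    exact ae_restrict_of_ae_restrict_of_subset Ioo_subset_Ioi_self hae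
  rw [h0] at htop
  exact ENNReal.zero_ne_top htop

/-- The weight integrals of the truncations of the weight near `0` and `∞` tend to zero. -/
lemma tendsto_weightInt_indicator_compl {lam p' q q' r : ℝ} (hp' : 0 < p') (hrq : 0 < r / q')
    {v : ℝ → ℝ≥0∞} (hv : Measurable v) (hW : weightInt lam p' q q' r v < ⊤) :
    Tendsto (fun n : ℕ => weightInt lam p' q q' r
      ((Ioo (1 / ((n:ℝ) + 1)) ((n:ℝ) + 1))ᶜ.indicator v)) atTop (𝓝 0) := by
  set F : ℝ → ℝ≥0∞ := fun t => ENNReal.ofReal t ^ (-(lam * r / q)) *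
    prim (fun y => v y ^ p') t ^ (r / q') * v t ^ p' with hF
  have hFm : Measurable F := by
    have : Measurable fun y => v y ^ p' := hv.pow_const _
    fun_prop
  have hlim : Tendsto (fun n : ℕ => ∫⁻ t in Ioi (0:ℝ),
      (Ioo (1 / ((n:ℝ) + 1)) ((n:ℝ) + 1))ᶜ.indicator F t) atTop
      (𝓝 (∫⁻ _ in Ioi (0:ℝ), 0)) := by
    refine tendsto_lintegral_of_dominated_convergence F
      (fun n => hFm.indicator measurableSet_Ioo.compl) (fun n => Eventually.of_forall fun t =>
        indicator_le_self _ _ _) hW.ne ?_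
    filter_upwards [ae_restrict_mem measurableSet_Ioi] with t ht
    rw [← iUnion_Ioo_one_div_succ, mem_iUnion] at ht
    obtain ⟨N, hN⟩ := ht
    refine tendsto_nhds_of_eventually_eq ?_
    filter_upwards [eventually_ge_atTop N] with n hn
    exact indicator_of_notMem (notMem_compl_iff.2 (monotone_Ioo_one_div_succ hn hN)) _
  rw [lintegral_zero] at hlim
  refine tendsto_of_tendsto_of_tendsto_of_le_of_le tendsto_const_nhds hlim
    (fun n => zero_le) fun n => ?_
  refine lintegral_mono fun t => ?_
  by_cases ht : t ∈ Ioo (1 / ((n:ℝ) + 1)) ((n:ℝ) + 1)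
  · rw [indicator_of_notMem (notMem_compl_iff.2 ht), ENNReal.zero_rpow_of_pos hp', mul_zero]
    exact zero_le
  · rw [indicator_of_mem (show t ∈ (Ioo (1 / ((n:ℝ) + 1)) ((n:ℝ) + 1))ᶜ from ht),
      indicator_of_mem (show t ∈ (Ioo (1 / ((n:ℝ) + 1)) ((n:ℝ) + 1))ᶜ from ht)]
    refine mul_le_mul_left (mul_le_mul_right (ENNReal.rpow_le_rpow ?_ hrq.le) _) _
    exact lintegral_mono fun y => ENNReal.rpow_le_rpow (indicator_le_self _ _ _) hp'.le

lemma lintegral_rpow_le_one_of_eN_le_one {p : ℝ} (hp : 0 < p) {f : ℝ → ℝ} (h : eN p f ≤ 1) :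
    ∫⁻ y in Ioi (0:ℝ), ENNReal.ofReal |f y| ^ p ≤ 1 := by
  have h1 := ENNReal.rpow_le_rpow h hp.le
  rwa [eN, ← ENNReal.rpow_mul, one_div_mul_cancel hp.ne', ENNReal.rpow_one,
    ENNReal.one_rpow] at h1

lemma enorm_exp_mul_mul (x y lam a : ℝ) {b : ℝ} (hb : 0 ≤ b) :
    ‖Real.exp (-(x * y ^ lam)) * a * b‖ₑ =
      ENNReal.ofReal (Real.exp (-(x * y ^ lam))) * (ENNReal.ofReal |a| * ENNReal.ofReal b) := by
  rw [Real.enorm_eq_ofReal_abs, abs_mul, abs_mul, abs_of_nonneg hb, Real.abs_exp,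
    ENNReal.ofReal_mul (by positivity), ENNReal.ofReal_mul (by positivity), mul_assoc]

/-- The operator norm of the part of the operator living outside `S` is controlled by the weight
integral of the truncated weight. -/
lemma eN_Lap_sub_indicator_le {lam p p' q q' r : ℝ} (hlam : 0 < lam) (hq : 1 < q) (hqp : q < p)
    (hpp : p.HolderConjugate p') (hqq : q.HolderConjugate q') (hr : r = p * q / (p - q))
    {v f : ℝ → ℝ} (hv : Measurable v) (hvpos : ∀ y, 0 ≤ v y) (hf : Measurable f)
    (hf1 : eN p f ≤ 1) (hfin : ∀ T, prim (fun y => ENNReal.ofReal (v y) ^ p') T < ⊤)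
    (hW : weightInt lam p' q q' r (fun y => ENNReal.ofReal (v y)) < ⊤)
    {S : Set ℝ} (hS : MeasurableSet S) :
    eN q (fun x => Lap lam v f x - Lap lam v (S.indicator f) x) ≤
      (ENNReal.ofReal q * (ENNReal.ofReal p' ^ p) ^ ((q - 1) / p) *
        weightInt lam p' q q' r (Sᶜ.indicator fun y => ENNReal.ofReal (v y)) ^ (q / r)) ^
        (1 / q) := by
  have hp0 := hpp.pos
  have hp'0 := hpp.symm.pos
  have hq0 := hqq.pos
  have hpq : 0 < p - q := by linarith
  have hr0 : 0 < r := by rw [hr]; positivity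
  set u : ℝ → ℝ≥0∞ := fun y => ENNReal.ofReal (v y) with hu
  have hum : Measurable u := by fun_prop
  have hSum : Measurable (Sᶜ.indicator u) := hum.indicator hS.compl
  have hFm : Measurable fun y => ENNReal.ofReal |f y| := by fun_prop
  have hF1 := lintegral_rpow_le_one_of_eN_le_one hp0 hf1
  have hFt := hF1.trans_lt ENNReal.one_lt_top
  have hbig := lintegral_eLap_mul_rpow_le hlam hq hqp hpp hqq hr hFm hum hfin hFt
  have hsmall := lintegral_eLap_mul_rpow_le hlam hq hqp hpp hqq hr hFm hSum (fun T =>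
    (lintegral_mono fun y => ENNReal.rpow_le_rpow (indicator_le_self _ _ _) hp'0.le).trans_lt
      (hfin T)) hFt
  refine ENNReal.rpow_le_rpow ?_ (by positivity)
  refine le_trans ?_ (hsmall.trans (mul_le_mul_left (mul_le_of_le_one_right' ?_) _))
  swap
  · exact (ENNReal.rpow_le_rpow hF1 (by positivity)).trans_eq (ENNReal.one_rpow _)
  have hae : ∀ᵐ x ∂volume.restrict (Ioi (0:ℝ)),
      eLap lam (fun y => ENNReal.ofReal |f y| * u y) x < ⊤ := by
    have hne : ∫⁻ x in Ioi (0:ℝ), eLap lam (fun y => ENNReal.ofReal |f y| * u y) x ^ q ≠ ⊤ := by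
      refine (hbig.trans_lt ?_).ne
      refine ENNReal.mul_lt_top (ENNReal.mul_lt_top (ENNReal.mul_lt_top ENNReal.ofReal_lt_top ?_)
        ?_) ?_
      · have : 0 ≤ (q - 1) / p := div_nonneg (by linarith) hp0.le
        exact ENNReal.rpow_lt_top_of_nonneg this
          (ENNReal.rpow_ne_top_of_nonneg hp0.le ENNReal.ofReal_ne_top)
      · exact ENNReal.rpow_lt_top_of_nonneg (by positivity) hFt.ne
      · exact ENNReal.rpow_lt_top_of_nonneg (by positivity) hW.ne
    filter_upwards [ae_lt_top ((measurable_eLap lam (hFm.mul hum)).pow_const q) hne] with x hx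
    exact (ENNReal.rpow_lt_top_iff_of_pos hq0).1 hx
  refine lintegral_mono_ae ?_
  filter_upwards [hae] with x hx
  refine ENNReal.rpow_le_rpow ?_ hq0.le
  have hintf : IntegrableOn (fun y => Real.exp (-(x * y ^ lam)) * f y * v y) (Ioi 0) := by
    refine ⟨(by fun_prop : Measurable _).aestronglyMeasurable, ?_⟩
    rw [HasFiniteIntegral]
    simp only [enorm_exp_mul_mul _ _ _ _ (hvpos _)]
    exact hx
  have hcut : ∀ y, Real.exp (-(x * y ^ lam)) * S.indicator f y * v y
      = S.indicator (fun y => Real.exp (-(x * y ^ lam)) * f y * v y) y := by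
    intro y
    by_cases hy : y ∈ S <;> simp [hy]
  have hintS : IntegrableOn (fun y => Real.exp (-(x * y ^ lam)) * S.indicator f y * v y)
      (Ioi 0) := by
    simp only [hcut]
    exact Integrable.indicator hintf hS
  rw [Lap, Lap, ← integral_sub hintf hintS, ← Real.enorm_eq_ofReal_abs]
  refine (enorm_integral_le_lintegral_enorm _).trans (lintegral_mono fun y => ?_)
  by_cases hy : y ∈ S
  · simp [hy]
  · have hy' : y ∈ Sᶜ := hy
    simp only [indicator_of_notMem hy, indicator_of_mem hy', mul_zero, zero_mul, sub_zero]
    exact (enorm_exp_mul_mul _ _ _ _ (hvpos _)).le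

lemma lintegral_indicator_Ioo_le_prim (a b : ℝ) (ha : 0 < a) (F : ℝ → ℝ≥0∞) :
    ∫⁻ y in Ioi (0:ℝ), (Ioo a b).indicator F y ≤ prim F b := by
  refine (setLIntegral_le_lintegral _ _).trans ?_
  rw [lintegral_indicator measurableSet_Ioo]
  exact lintegral_mono_set (Ioo_subset_Ioo_left ha.le)

lemma enorm_Lap_indicator_le {lam a b x : ℝ} (hlam : 0 < lam) (ha : 0 < a) (hx : 0 ≤ x)
    {v f : ℝ → ℝ} (hvpos : ∀ y, 0 ≤ v y) :
    ‖Lap lam v ((Ioo a b).indicator f) x‖ₑ ≤ ENNReal.ofReal (Real.exp (-(x * a ^ lam))) *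
      prim (fun y => ENNReal.ofReal |f y| * ENNReal.ofReal (v y)) b := by
  refine (enorm_integral_le_lintegral_enorm _).trans (le_trans ?_
    (mul_le_mul_right (lintegral_indicator_Ioo_le_prim a b ha _) _))
  rw [← lintegral_const_mul' _ _ ENNReal.ofReal_ne_top]
  refine lintegral_mono fun y => ?_
  by_cases hy : y ∈ Ioo a b
  · rw [indicator_of_mem hy, indicator_of_mem hy, enorm_exp_mul_mul _ _ _ _ (hvpos _)]
    refine mul_le_mul_left (ENNReal.ofReal_le_ofReal (Real.exp_le_exp.2 (neg_le_neg ?_))) _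
    exact mul_le_mul_of_nonneg_left (Real.rpow_le_rpow ha.le hy.1.le hlam.le) hx
  · simp [hy]

lemma abs_exp_neg_sub_exp_neg_le {s t : ℝ} (hs : 0 ≤ s) (ht : 0 ≤ t) :
    |Real.exp (-s) - Real.exp (-t)| ≤ |s - t| := by
  wlog hst : s ≤ t generalizing s t
  · rw [abs_sub_comm, abs_sub_comm s]
    exact this ht hs (le_of_not_ge hst)
  rw [abs_of_nonneg (sub_nonneg.2 (Real.exp_le_exp.2 (neg_le_neg hst))),
    abs_of_nonpos (sub_nonpos.2 hst)]
  have h1 : Real.exp (-t) = Real.exp (-s) * Real.exp (s - t) := by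
    rw [← Real.exp_add]; ring_nf
  have h2 : s - t + 1 ≤ Real.exp (s - t) := Real.add_one_le_exp _
  have h3 : Real.exp (-s) ≤ 1 := Real.exp_le_one_iff.2 (by linarith)
  have h4 := Real.exp_pos (-s)
  rw [h1]
  nlinarith

lemma enorm_Lap_indicator_sub_le {lam a b x x' : ℝ} (hlam : 0 < lam) (ha : 0 < a) (hx : 0 ≤ x)
    (hx' : 0 ≤ x') {v f : ℝ → ℝ} (hvpos : ∀ y, 0 ≤ v y) (hv : Measurable v) (hf : Measurable f)
    (hfin : prim (fun y => ENNReal.ofReal |f y| * ENNReal.ofReal (v y)) b < ⊤) :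
    ‖Lap lam v ((Ioo a b).indicator f) x - Lap lam v ((Ioo a b).indicator f) x'‖ₑ ≤
      ENNReal.ofReal (|x - x'| * b ^ lam) *
        prim (fun y => ENNReal.ofReal |f y| * ENNReal.ofReal (v y)) b := by
  have hfm : Measurable ((Ioo a b).indicator f) := hf.indicator measurableSet_Ioo
  have hint : ∀ z, 0 ≤ z → IntegrableOn
      (fun y => Real.exp (-(z * y ^ lam)) * (Ioo a b).indicator f y * v y) (Ioi 0) := by
    intro z hz
    refine ⟨(by fun_prop : Measurable _).aestronglyMeasurable, ?_⟩
    refine lt_of_le_of_lt ?_ ((lintegral_indicator_Ioo_le_prim a b ha _).trans_lt hfin)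
    refine lintegral_mono fun y => ?_
    by_cases hy : y ∈ Ioo a b
    · have hy0 : 0 < y := ha.trans hy.1
      beta_reduce
      rw [indicator_of_mem hy, indicator_of_mem hy, enorm_exp_mul_mul _ _ _ _ (hvpos _)]
      refine mul_le_of_le_one_left' ?_
      rw [ENNReal.ofReal_le_one, Real.exp_le_one_iff, neg_nonpos]
      positivity
    · simp [hy]
  rw [Lap, Lap, ← integral_sub (hint x hx) (hint x' hx')]
  refine (enorm_integral_le_lintegral_enorm _).trans (le_trans ?_
    (mul_le_mul_right (lintegral_indicator_Ioo_le_prim a b ha _) _))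
  rw [← lintegral_const_mul' _ _ ENNReal.ofReal_ne_top]
  refine lintegral_mono fun y => ?_
  by_cases hy : y ∈ Ioo a b
  · have hy0 : 0 < y := ha.trans hy.1
    rw [indicator_of_mem hy, indicator_of_mem hy, mul_assoc, mul_assoc, ← sub_mul,
      Real.enorm_eq_ofReal_abs, abs_mul, abs_mul, abs_of_nonneg (hvpos y),
      ENNReal.ofReal_mul (by positivity), ENNReal.ofReal_mul (by positivity)]
    refine mul_le_mul_left (ENNReal.ofReal_le_ofReal ?_) _
    refine (abs_exp_neg_sub_exp_neg_le (by positivity) (by positivity)).trans ?_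
    rw [← sub_mul, abs_mul, abs_of_nonneg (by positivity : 0 ≤ y ^ lam)]
    exact mul_le_mul_of_nonneg_left (Real.rpow_le_rpow hy0.le hy.2.le hlam.le) (abs_nonneg _)
  · simp [hy]

/-- Diagonal Arzelà–Ascoli extraction on `(0,∞)` for countably many bounded, equi-Lipschitz
sequences of functions. -/
lemma exists_subseq_forall_cauchySeq {G : ℕ → ℕ → ℝ → ℝ} {C D : ℕ → ℝ}
    (hC : ∀ n k x, 0 ≤ x → |G n k x| ≤ C k)
    (hD : ∀ n k x x', 0 ≤ x → 0 ≤ x' → |G n k x - G n k x'| ≤ D k * |x - x'|) :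
    ∃ φ : ℕ → ℕ, StrictMono φ ∧ ∀ k, ∀ x, 0 < x → CauchySeq fun n => G (φ n) k x := by
  obtain ⟨l, -, φ, hφ, hl⟩ := (isCompact_univ_pi fun z : ℕ × ℚ =>
    (isCompact_Icc : IsCompact (Icc (-C z.1) (C z.1)))).tendsto_subseq
    (x := fun n z => G n z.1 |(z.2 : ℝ)|)
    (fun n z _ => abs_le.1 (hC n z.1 _ (abs_nonneg _)))
  refine ⟨φ, hφ, fun k x hx => ?_⟩
  rw [Metric.cauchySeq_iff]
  intro ε hε
  have hDk : 0 < |D k| + 1 := by positivity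
  obtain ⟨s, hs1, hs2⟩ := exists_rat_btwn (show x < x + ε / (3 * (|D k| + 1)) by
    have : 0 < ε / (3 * (|D k| + 1)) := by positivity
    linarith)
  have hs0 : (0:ℝ) < s := hx.trans hs1
  have hc : CauchySeq fun n => G (φ n) k |(s : ℝ)| :=
    ((tendsto_pi_nhds.1 hl) (k, s)).cauchySeq
  obtain ⟨N, hN⟩ := Metric.cauchySeq_iff.1 hc (ε / 3) (by positivity)
  refine ⟨N, fun m hm n hn => ?_⟩
  have hb : ∀ i, |G (φ i) k x - G (φ i) k s| < ε / 3 := by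
    intro i
    refine (hD (φ i) k x s hx.le hs0.le).trans_lt ?_
    have h1 : |x - s| < ε / (3 * (|D k| + 1)) := by
      rw [abs_sub_comm, abs_of_pos (by linarith)]; linarith
    calc D k * |x - s| ≤ (|D k| + 1) * |x - s| :=
          mul_le_mul_of_nonneg_right (by linarith [le_abs_self (D k)]) (abs_nonneg _)
      _ < (|D k| + 1) * (ε / (3 * (|D k| + 1))) := mul_lt_mul_of_pos_left h1 hDk
      _ = ε / 3 := by field_simp
  have h := hN m hm n hn
  rw [Real.dist_eq, abs_of_pos hs0] at h
  have hbm := abs_lt.1 (hb m)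
  have hbn := abs_lt.1 (hb n)
  have habs := abs_lt.1 h
  rw [Real.dist_eq, abs_lt]
  constructor <;> linarith [hbm.1, hbm.2, hbn.1, hbn.2, habs.1, habs.2]

/-- A dominated, pointwise Cauchy sequence is Cauchy in `L^q(0,∞)`. -/
lemma tendsto_eN_sub_of_dominated {q : ℝ} (hq : 0 < q) {g : ℕ → ℝ → ℝ}
    (hg : ∀ n, Measurable (g n)) {E : ℝ → ℝ≥0∞} (hE : ∀ n x, 0 < x → ‖g n x‖ₑ ≤ E x)
    (hEfin : ∫⁻ x in Ioi (0:ℝ), E x ^ q ≠ ⊤) (hc : ∀ x, 0 < x → CauchySeq fun n => g n x) :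
    Tendsto (fun z : ℕ × ℕ => eN q fun x => g z.1 x - g z.2 x) atTop (𝓝 0) := by
  have hlim : Tendsto (fun z : ℕ × ℕ => ∫⁻ x in Ioi (0:ℝ), ENNReal.ofReal |g z.1 x - g z.2 x| ^ q)
      atTop (𝓝 (∫⁻ _ in Ioi (0:ℝ), 0)) := by
    refine tendsto_lintegral_filter_of_dominated_convergence (fun x => 2 ^ q * E x ^ q)
      (Eventually.of_forall fun z => ?_) (Eventually.of_forall fun z => ?_) ?_ ?_
    · have h1 := hg z.1
      have h2 := hg z.2
      have h3 : Measurable fun x => |g z.1 x - g z.2 x| := (h1.sub h2).abs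
      fun_prop
    · filter_upwards [ae_restrict_mem measurableSet_Ioi] with x hx
      rw [← ENNReal.mul_rpow_of_nonneg _ _ hq.le, ← Real.enorm_eq_ofReal_abs, two_mul]
      exact ENNReal.rpow_le_rpow (enorm_sub_le.trans (add_le_add (hE _ x hx) (hE _ x hx))) hq.le
    · have h2 : (2:ℝ≥0∞) ^ q ≠ ⊤ := ENNReal.rpow_ne_top_of_nonneg hq.le (by simp)
      rw [lintegral_const_mul' _ _ h2]
      exact ENNReal.mul_ne_top h2 hEfin
    · filter_upwards [ae_restrict_mem measurableSet_Ioi] with x hx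
      have h1 := cauchySeq_iff_tendsto_dist_atTop_0.1 (hc x hx)
      have h2 := (ENNReal.continuous_rpow_const (y := q)).tendsto _ |>.comp
        (ENNReal.tendsto_ofReal h1)
      simpa [Function.comp_def, Real.dist_eq, hq] using h2
  rw [lintegral_zero] at hlim
  have h := ((ENNReal.continuous_rpow_const (y := 1 / q)).tendsto _).comp hlim
  rwa [ENNReal.zero_rpow_of_pos (by positivity)] at h

/-- Sufficiency: a finite weight integral makes the Laplace-type operator compact. -/
lemma lapCompact_of_weightInt_lt_top {lam p p' q q' r : ℝ} (hlam : 0 < lam) (hq : 1 < q)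
    (hqp : q < p) (hpp : p.HolderConjugate p') (hqq : q.HolderConjugate q')
    (hr : r = p * q / (p - q)) {v : ℝ → ℝ} (hv : Measurable v) (hvpos : ∀ y, 0 ≤ v y)
    (hloc : LocallyIntegrableOn (fun y => v y ^ p') (Ioi (0:ℝ)))
    (hW : weightInt lam p' q q' r (fun y => ENNReal.ofReal (v y)) < ⊤) :
    LapCompact lam p q v := by
  have hp0 := hpp.pos
  have hp'0 := hpp.symm.pos
  have hq0 := hqq.pos
  have hq'0 := hqq.symm.pos
  have hpq : 0 < p - q := by linarith
  have hr0 : 0 < r := by rw [hr]; positivity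
  have hfin := prim_lt_top_of_weightInt_lt_top hp'0 (div_pos hr0 hq'0) hv hvpos hloc hW
  intro f hfm hf1
  set S : ℕ → Set ℝ := fun k => Ioo (1 / ((k:ℝ) + 1)) ((k:ℝ) + 1) with hS
  set G : ℕ → ℕ → ℝ → ℝ := fun n k => Lap lam v ((S k).indicator (f n)) with hG
  have hLm : ∀ n, Measurable (Lap lam v (f n)) := fun n => measurable_Lap lam hv (hfm n)
  have hGm : ∀ n k, Measurable (G n k) := fun n k =>
    measurable_Lap lam hv ((hfm n).indicator measurableSet_Ioo)
  have ha : ∀ k : ℕ, 0 < 1 / ((k:ℝ) + 1) := fun k => by positivity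
  set D : ℕ → ℝ≥0∞ := fun k => prim (fun y => ENNReal.ofReal (v y) ^ p') ((k:ℝ) + 1) ^ (1 / p')
    with hD
  have hDt : ∀ k, D k < ⊤ := fun k =>
    ENNReal.rpow_lt_top_of_nonneg (by positivity) (hfin _).ne
  have hprim : ∀ n k : ℕ,
      prim (fun y => ENNReal.ofReal |f n y| * ENNReal.ofReal (v y)) ((k:ℝ) + 1) ≤ D k := by
    intro n k
    have hfn := hfm n
    refine (prim_mul_le hpp (by fun_prop) (by fun_prop) _).trans (mul_le_of_le_one_left' ?_)
    refine ENNReal.rpow_le_one ?_ (by positivity)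
    exact (lintegral_mono_set Ioo_subset_Ioi_self).trans
      (lintegral_rpow_le_one_of_eN_le_one hp0 (hf1 n))
  have hGb : ∀ n k x, 0 ≤ x →
      ‖G n k x‖ₑ ≤ ENNReal.ofReal (Real.exp (-(x * (1 / ((k:ℝ) + 1)) ^ lam))) * D k :=
    fun n k x hx => (enorm_Lap_indicator_le hlam (ha k) hx hvpos).trans
      (mul_le_mul_right (hprim n k) _)
  obtain ⟨φ, hφ, hcau⟩ := exists_subseq_forall_cauchySeq (G := G) (C := fun k => (D k).toReal)
    (D := fun k => ((k:ℝ) + 1) ^ lam * (D k).toReal)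
    (fun n k x hx => by
      rw [← ENNReal.ofReal_le_iff_le_toReal (hDt k).ne, ← Real.enorm_eq_ofReal_abs]
      refine (hGb n k x hx).trans (mul_le_of_le_one_left' ?_)
      rw [ENNReal.ofReal_le_one, Real.exp_le_one_iff, neg_nonpos]
      positivity)
    (fun n k x x' hx hx' => by
      have h := (enorm_Lap_indicator_sub_le hlam (ha k) hx hx' hvpos hv (hfm n)
        ((hprim n k).trans_lt (hDt k))).trans (mul_le_mul_right (hprim n k) _)
      rw [Real.enorm_eq_ofReal_abs, ENNReal.ofReal_le_iff_le_toReal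
        (ENNReal.mul_ne_top ENNReal.ofReal_ne_top (hDt k).ne), ENNReal.toReal_mul,
        ENNReal.toReal_ofReal (by positivity)] at h
      linarith)
  refine ⟨φ, hφ, fun ε hε => ?_⟩
  have hε3 : 0 < ENNReal.ofReal (ε / 3) := ENNReal.ofReal_pos.2 (by positivity)
  -- the part of the operator outside `S k` is small in norm
  obtain ⟨k, hk⟩ : ∃ k : ℕ, ∀ n, eN q (fun x => Lap lam v (f n) x - G n k x)
      < ENNReal.ofReal (ε / 3) := by
    set K := ENNReal.ofReal q * (ENNReal.ofReal p' ^ p) ^ ((q - 1) / p) with hK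
    have hKt : K ≠ ⊤ := ENNReal.mul_ne_top ENNReal.ofReal_ne_top
      (ENNReal.rpow_ne_top_of_nonneg (div_nonneg (by linarith) hp0.le)
        (ENNReal.rpow_ne_top_of_nonneg hp0.le ENNReal.ofReal_ne_top))
    have h0 := tendsto_weightInt_indicator_compl hp'0 (div_pos hr0 hq'0) (by fun_prop) hW
    have h1 := ((ENNReal.continuous_rpow_const (y := q / r)).tendsto _).comp h0
    have h2 := ((ENNReal.continuous_rpow_const (y := 1 / q)).tendsto _).comp
      (ENNReal.Tendsto.const_mul h1 (Or.inr hKt))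
    rw [ENNReal.zero_rpow_of_pos (by positivity), mul_zero,
      ENNReal.zero_rpow_of_pos (by positivity)] at h2
    obtain ⟨k, hk⟩ := (h2.eventually_lt_const hε3).exists
    exact ⟨k, fun n => (eN_Lap_sub_indicator_le hlam hq hqp hpp hqq hr hv hvpos (hfm n) (hf1 n)
      hfin hW measurableSet_Ioo).trans_lt hk⟩
  -- the part of the operator on `S k` converges along the subsequence
  have hEfin : ∫⁻ x in Ioi (0:ℝ),
      (ENNReal.ofReal (Real.exp (-(x * (1 / ((k:ℝ) + 1)) ^ lam))) * D k) ^ q ≠ ⊤ := by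
    have hb : 0 < (1 / ((k:ℝ) + 1)) ^ lam * q := mul_pos (Real.rpow_pos_of_pos (ha k) _) hq0
    have he : ∀ x, (ENNReal.ofReal (Real.exp (-(x * (1 / ((k:ℝ) + 1)) ^ lam))) * D k) ^ q
        = ENNReal.ofReal (Real.exp (-((1 / ((k:ℝ) + 1)) ^ lam * q) * x)) * D k ^ q := by
      intro x
      rw [ENNReal.mul_rpow_of_nonneg _ _ hq0.le, ENNReal.ofReal_rpow_of_pos (Real.exp_pos _),
        ← Real.exp_mul]
      congr 3
      ring
    have hDq : D k ^ q ≠ ⊤ := ENNReal.rpow_ne_top_of_nonneg hq0.le (hDt k).ne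
    simp only [he]
    rw [lintegral_mul_const' _ _ hDq]
    exact ENNReal.mul_ne_top (exp_neg_integrableOn_Ioi 0 hb).lintegral_lt_top.ne hDq
  have hlim := tendsto_eN_sub_of_dominated hq0 (fun n => hGm (φ n) k)
    (fun n x hx => hGb (φ n) k x hx.le) hEfin (hcau k)
  obtain ⟨⟨N₁, N₂⟩, hN⟩ := eventually_atTop.1 (hlim.eventually_lt_const hε3)
  refine ⟨max N₁ N₂, fun m hm n hn => ?_⟩
  have hmid := hN (m, n) ⟨(le_max_left _ _).trans hm, (le_max_right _ _).trans hn⟩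
  have hsymm : eN q (fun x => G (φ n) k x - Lap lam v (f (φ n)) x)
      = eN q (fun x => Lap lam v (f (φ n)) x - G (φ n) k x) := by
    simp only [eN, abs_sub_comm]
  calc eN q (fun x => Lap lam v (f (φ m)) x - Lap lam v (f (φ n)) x)
      = eN q (fun x => (Lap lam v (f (φ m)) x - G (φ m) k x) +
          ((G (φ m) k x - G (φ n) k x) + (G (φ n) k x - Lap lam v (f (φ n)) x))) := by
        congr 1
        ext x
        ring
    _ ≤ eN q (fun x => Lap lam v (f (φ m)) x - G (φ m) k x) +
          (eN q (fun x => G (φ m) k x - G (φ n) k x) +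
            eN q (fun x => G (φ n) k x - Lap lam v (f (φ n)) x)) :=
        (eN_add_le hq.le ((hLm _).sub (hGm _ _)) (((hGm _ _).sub (hGm _ _)).add
          ((hGm _ _).sub (hLm _)))).trans (add_le_add_right (eN_add_le hq.le
          ((hGm _ _).sub (hGm _ _)) ((hGm _ _).sub (hLm _))) _)
    _ < ENNReal.ofReal (ε / 3) + (ENNReal.ofReal (ε / 3) + ENNReal.ofReal (ε / 3)) :=
        ENNReal.add_lt_add (hk _) (ENNReal.add_lt_add hmid (hsymm ▸ hk _))
    _ = ENNReal.ofReal ε := by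
        rw [← ENNReal.ofReal_add (by positivity) (by positivity),
          ← ENNReal.ofReal_add (by positivity) (by positivity)]
        congr 1
        ring

theorem stmt6 (lam p q : ℝ) (hlam : 0 < lam) (hq : 1 < q) (hqp : q < p)
    (v : ℝ → ℝ) (hv : Measurable v) (hvpos : ∀ y, 0 ≤ v y)
    (p' q' r : ℝ)
    (hp' : p' = p / (p - 1)) (hq' : q' = q / (q - 1)) (hr : r = p * q / (p - q))
    (hloc : LocallyIntegrableOn (fun y => v y ^ p') (Ioi (0:ℝ)))
    (B : ℝ≥0∞)
    -- `B = (∫_0^∞ t^{-λr/q} (∫_0^t v^{p'})^{r/q'} v(t)^{p'} dt)^{1/r}`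
    (hB : B = (∫⁻ t in Ioi (0:ℝ), (ENNReal.ofReal t) ^ (-(lam * r / q)) *
      (∫⁻ y in Ioo (0:ℝ) t, ENNReal.ofReal (v y) ^ p') ^ (r/q')
        * ENNReal.ofReal (v t) ^ p') ^ (1/r)) :
    LapCompact lam p q v ↔ B < ⊤ := by
  have hpp : p.HolderConjugate p' := by
    rw [hp']
    exact Real.HolderConjugate.conjExponent (hq.trans hqp)
  have hqq : q.HolderConjugate q' := by
    rw [hq']
    exact Real.HolderConjugate.conjExponent hq
  have hr0 : 0 < r := by
    have := hpp.pos
    have := hqq.pos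
    have : 0 < p - q := by linarith
    rw [hr]
    positivity
  have hBW : B < ⊤ ↔ weightInt lam p' q q' r (fun y => ENNReal.ofReal (v y)) < ⊤ := by
    rw [hB, ENNReal.rpow_lt_top_iff_of_pos (by positivity)]
    rfl
  rw [hBW]
  constructor
  · intro h
    obtain ⟨C, hCt, hC⟩ := h.exists_bound hpp.pos hq.le hv
    exact weightInt_lt_top_of_bound hlam hqp hpp hqq hr hv hvpos hloc hCt hC
  · exact lapCompact_of_weightInt_lt_top hlam hq hqp hpp hqq hr hv hvpos hloc
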